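/- arXiv:2512.12546 — 8 statements merged into one kernel-verified Lean document; each statement's English description precedes it below -/
import Mathlib

section
/- For every ⋆ ∈ {full, new, min} and every integer N ≥ 1, one has 0 ≤ ν∞^⋆(N) and ν∞^⋆(N)·√N ≤ ψ^⋆(N). -/
noncomputable section

/-- Value at `N` of the multiplicative function determined by local values `f p e`
on prime powers `p^e` (`e ≥ 1`). -/
def mval (f : ℕ → ℕ → ℝ) (N : ℕ) : ℝ := ∏ p ∈ N.primeFactors, f p (N.factorization p)

def psiFull : ℕ → ℝ := mval fun p e => (p:ℝ)^e + (p:ℝ)^(e-1)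

def nuInfFull : ℕ → ℝ := mval fun p e =>
  if Odd e then 2*(p:ℝ)^((e-1)/2) else (p:ℝ)^(e/2) + (p:ℝ)^(e/2-1)

def nu2Full : ℕ → ℝ := mval fun p e =>
  if p^e = 2 then 1 else if p % 4 = 1 then 2 else 0

def nu3Full : ℕ → ℝ := mval fun p e =>
  if p^e = 3 then 1 else if p % 3 = 1 then 2 else 0

def psiNew : ℕ → ℝ := mval fun p e =>
  if e = 1 then (p:ℝ)-1
  else if e = 2 then (p:ℝ)^2-(p:ℝ)-1
  else (p:ℝ)^(e-3)*((p:ℝ)-1)^2*((p:ℝ)+1)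

def nuInfNew : ℕ → ℝ := mval fun p e =>
  if e = 2 then (p:ℝ)-2
  else if Even e ∧ 2 < e then (p:ℝ)^(e/2-2)*((p:ℝ)-1)^2
  else 0

def nu2New : ℕ → ℝ := mval fun p e =>
  if p % 4 = 3 ∧ e = 1 then -2
  else if (p % 4 = 3 ∧ e = 2) ∨ p^e = 8 then 1
  else if (p % 4 = 1 ∧ e = 2) ∨ p^e = 2 ∨ p^e = 4 then -1
  else 0

def nu3New : ℕ → ℝ := mval fun p e =>
  if p % 3 = 2 ∧ e = 1 then -2
  else if (p % 3 = 2 ∧ e = 2) ∨ p^e = 27 then 1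
  else if (p % 3 = 1 ∧ e = 2) ∨ p^e = 3 ∨ p^e = 9 then -1
  else 0

def psiMin : ℕ → ℝ := mval fun p e =>
  ((p:ℝ)-1)/((Nat.gcd (Nat.gcd 2 (p-1)) e : ℕ) : ℝ)
    * (if e = 1 then 1 else if e = 2 then (p:ℝ)-1 else (p:ℝ)^(e-3)*((p:ℝ)^2-1))

def nuInfMin : ℕ → ℝ := mval fun p e =>
  if p = 2 ∧ Even e ∧ 2 < e then (2:ℝ)^(e/2-2) else 0

def nu2Min : ℕ → ℝ := mval fun p e =>
  if p % 4 = 3 then -2*((ArithmeticFunction.moebius (p^(e-1)) : ℤ) : ℝ)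
  else if p^e = 2 ∨ p^e = 4 then -1
  else if p^e = 8 then 1
  else 0

def nu3Min : ℕ → ℝ := mval fun p e =>
  if p % 3 = 2 ∧ p^e ≠ 4 then -2*((ArithmeticFunction.moebius (p^(e-1)) : ℤ) : ℝ)
  else if p^e = 3 ∨ p^e = 9 then -1
  else if p^e = 4 ∨ p^e = 27 then 1
  else 0

/-- The Kronecker symbol `(−4|n)`, i.e. the nontrivial character mod 4. -/
def chi4 (n : ℕ) : ℝ := if n % 4 = 1 then 1 else if n % 4 = 3 then -1 else 0

/-- The Kronecker symbol `(−3|n)`, i.e. the nontrivial character mod 3. -/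
def chi3 (n : ℕ) : ℝ := if n % 3 = 1 then 1 else if n % 3 = 2 then -1 else 0

def c2 (k : ℕ) : ℝ := -(1/4) * chi4 (k-1)

def c3 (k : ℕ) : ℝ := -(1/3) * chi3 (k-1)

def delta2 (k : ℕ) : ℝ := if k = 2 then 1 else 0

def dFull (k N : ℕ) : ℝ :=
  ((k:ℝ)-1)/12 * psiFull N - 1/2 * nuInfFull N + c2 k * nu2Full N + c3 k * nu3Full N
    + delta2 k

def dNew (k N : ℕ) : ℝ :=
  ((k:ℝ)-1)/12 * psiNew N - 1/2 * nuInfNew N + c2 k * nu2New N + c3 k * nu3New N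
    + delta2 k * ((ArithmeticFunction.moebius N : ℤ) : ℝ)

def dMin (k N : ℕ) : ℝ :=
  ((k:ℝ)-1)/12 * psiMin N - 1/2 * nuInfMin N + c2 k * nu2Min N + c3 k * nu3Min N
    + delta2 k * ((ArithmeticFunction.moebius N : ℤ) : ℝ)

/-- `ω(N)`: the number of distinct prime divisors of `N`. -/
def omega (N : ℕ) : ℕ := N.primeFactors.card

/-- A positive integer is squarefull if `p² ∣ N` for every prime `p ∣ N`. -/
def Squarefull (n : ℕ) : Prop := ∀ p : ℕ, p.Prime → p ∣ n → p^2 ∣ n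

/-- `H(N)`: the largest squarefull divisor of `N`. -/
def squarefullPart (N : ℕ) : ℕ := sSup {d : ℕ | d ∣ N ∧ Squarefull d}

/-- `η = ζ(3/2)/ζ(3)`. -/
def eta : ℝ := (riemannZeta (3/2) / riemannZeta 3).re

/-- Ford's coefficients `a_n = (n+1)log(n+1) − n log n − 1`. -/
def fordA (n : ℕ) : ℝ := ((n:ℝ)+1)*Real.log ((n:ℝ)+1) - (n:ℝ)*Real.log n - 1


def loglog (x : ℝ) : ℝ := Real.log (Real.log x)

def logloglog (x : ℝ) : ℝ := Real.log (Real.log (Real.log x))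

def loglogloglog (x : ℝ) : ℝ := Real.log (Real.log (Real.log (Real.log x)))

end

theorem mval_aux (f g : ℕ → ℕ → ℝ)
    (h : ∀ p e : ℕ, p.Prime → 1 ≤ e → 0 ≤ f p e ∧ f p e * Real.sqrt ((p:ℝ)^e) ≤ g p e)
    (N : ℕ) (hN : 1 ≤ N) : 0 ≤ mval f N ∧ mval f N * Real.sqrt N ≤ mval g N := by
  have key : ∀ p ∈ N.primeFactors, 0 ≤ f p (N.factorization p) ∧
      f p (N.factorization p) * Real.sqrt ((p:ℝ)^(N.factorization p)) ≤ g p (N.factorization p) := by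
    intro p hp
    have hp' := Nat.mem_primeFactors.mp hp
    exact h p _ hp'.1 (hp'.1.factorization_pos_of_dvd hp'.2.2 hp'.2.1)
  refine ⟨Finset.prod_nonneg fun p hp => (key p hp).1, ?_⟩
  have hs : ∀ s : Finset ℕ, Real.sqrt (∏ p ∈ s, (p:ℝ)^(N.factorization p))
      = ∏ p ∈ s, Real.sqrt ((p:ℝ)^(N.factorization p)) := by
    intro s
    induction s using Finset.induction_on with
    | empty => simp
    | insert a s ha ih =>
      rw [Finset.prod_insert ha, Finset.prod_insert ha, Real.sqrt_mul (by positivity), ih]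
  have hN' : (N:ℝ) = ∏ p ∈ N.primeFactors, (p:ℝ)^(N.factorization p) := by
    conv_lhs => rw [← Nat.prod_factorization_pow_eq_self (show N ≠ 0 by omega)]
    simp [Finsupp.prod]
  conv_lhs => rw [hN', hs]
  unfold mval
  rw [← Finset.prod_mul_distrib]
  exact Finset.prod_le_prod (fun p hp => mul_nonneg (key p hp).1 (Real.sqrt_nonneg _))
    fun p hp => (key p hp).2

theorem sqrt_even_aux (p : ℝ) (hp : 0 ≤ p) (m : ℕ) : Real.sqrt (p^(m+m)) = p^m := by
  rw [pow_add, Real.sqrt_mul_self (by positivity)]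

theorem nuInf_bounds (N : ℕ) (hN : 1 ≤ N) :
    (0 ≤ nuInfFull N ∧ nuInfFull N * Real.sqrt N ≤ psiFull N) ∧
    (0 ≤ nuInfNew N ∧ nuInfNew N * Real.sqrt N ≤ psiNew N) ∧
    (0 ≤ nuInfMin N ∧ nuInfMin N * Real.sqrt N ≤ psiMin N) := by
  refine ⟨mval_aux _ _ ?_ N hN, mval_aux _ _ ?_ N hN, mval_aux _ _ ?_ N hN⟩
  · intro p e hp he
    have hp2 : (2:ℝ) ≤ p := by exact_mod_cast hp.two_le
    split_ifs with ho
    · obtain ⟨m, rfl⟩ := ho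
      refine ⟨by positivity, ?_⟩
      have h1 : (2*m+1-1)/2 = m := by omega
      have h2 : 2*m+1-1 = m+m := by omega
      rw [h1, h2, show 2*m+1 = m+m+1 by omega, pow_succ, Real.sqrt_mul (by positivity),
        sqrt_even_aux _ (by positivity)]
      have hs : Real.sqrt p * Real.sqrt p = p := Real.mul_self_sqrt (by positivity)
      have hq : 0 ≤ (p:ℝ)^(m+m) * (Real.sqrt p - 1)^2 := by positivity
      have : (p:ℝ)^(m+m) * (Real.sqrt p - 1)^2 = (p:ℝ)^(m+m) * (Real.sqrt p * Real.sqrt p)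
        + (p:ℝ)^(m+m) - 2 * (p:ℝ)^m * ((p:ℝ)^m * Real.sqrt p) := by rw [pow_add]; ring
      rw [hs] at this
      linarith
    · refine ⟨by positivity, ?_⟩
      rw [Nat.not_odd_iff_even] at ho
      obtain ⟨m, rfl⟩ := ho
      obtain ⟨k, rfl⟩ : ∃ k, m = k+1 := ⟨m-1, by omega⟩
      rw [sqrt_even_aux _ (by positivity), show (k+1+(k+1))/2 = k+1 by omega,
        show k+1-1 = k by omega, show k+1+(k+1)-1 = k+k+1 by omega]
      apply le_of_eq; ring
  · intro p e hp he
    have hp2 : (2:ℝ) ≤ p := by exact_mod_cast hp.two_le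
    have hp1 : (0:ℝ) ≤ (p:ℝ) - 1 := by linarith
    by_cases h2 : e = 2
    · subst h2
      simp only [if_true]
      refine ⟨by linarith, ?_⟩
      rw [if_neg (by norm_num), Real.sqrt_sq (by positivity)]
      nlinarith
    rw [if_neg h2, if_neg h2]
    split_ifs with ho h1 h1
    · omega
    · refine ⟨by positivity, ?_⟩
      obtain ⟨⟨m, rfl⟩, hm⟩ := ho
      obtain ⟨k, rfl⟩ : ∃ k, m = k+2 := ⟨m-2, by omega⟩
      rw [sqrt_even_aux _ (by positivity), show (k+2+(k+2))/2-2 = k by omega,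
        show k+2+(k+2)-3 = k+k+1 by omega]
      have : 0 ≤ (p:ℝ)^(k+k+1) * ((p:ℝ)-1)^2 := by positivity
      calc _ = (p:ℝ)^(k+k+1) * ((p:ℝ)-1)^2 * p := by ring
        _ ≤ _ := by nlinarith
    · simpa using hp1
    · simp only [le_refl, zero_mul, true_and]; positivity
  · intro p e hp he
    have hp2 : (2:ℝ) ≤ p := by exact_mod_cast hp.two_le
    have hp1 : (0:ℝ) ≤ (p:ℝ) - 1 := by linarith
    have hp3 : (0:ℝ) ≤ (p:ℝ)^2 - 1 := by nlinarith
    split_ifs with ho h1 h2 h1 h2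
    · omega
    · omega
    · refine ⟨by positivity, ?_⟩
      obtain ⟨rfl, ⟨m, rfl⟩, hm⟩ := ho
      obtain ⟨k, rfl⟩ : ∃ k, m = k+2 := ⟨m-2, by omega⟩
      rw [sqrt_even_aux _ (by positivity), show (k+2+(k+2))/2-2 = k by omega,
        show k+2+(k+2)-3 = k+k+1 by omega]
      have : (0:ℝ) ≤ 2^(k+k) := by positivity
      norm_num
      calc _ = (2:ℝ)^(k+k) * 4 := by ring
        _ ≤ (2:ℝ)^(k+k) * 6 := by linarith
        _ = _ := by ring
    all_goals simp only [le_refl, zero_mul, true_and]; positivity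
end

section
/- For every ⋆ ∈ {full, new, min}, every even integer k ≥ 2, and every integer N ≥ 1, one has |c₂(k)·ν₂^⋆(N) + c₃(k)·ν₃^⋆(N)| ≤ (7/12)·2^{ω(N)}, where ω(N) is the number of distinct prime divisors of N. -/
theorem mval_abs_le (f : ℕ → ℕ → ℝ) (hf : ∀ p e, |f p e| ≤ 2) (N : ℕ) :
    |mval f N| ≤ (2:ℝ)^(omega N) := by
  unfold mval omega
  rw [Finset.abs_prod]
  calc ∏ p ∈ N.primeFactors, |f p (N.factorization p)|
      ≤ ∏ _p ∈ N.primeFactors, (2:ℝ) :=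
        Finset.prod_le_prod (fun _ _ => abs_nonneg _) (fun _ _ => hf _ _)
    _ = _ := by simp

theorem abs_two_moebius_le (n : ℕ) :
    |(-2 * ((ArithmeticFunction.moebius n : ℤ) : ℝ))| ≤ 2 := by
  have h : |ArithmeticFunction.moebius n| ≤ 1 := ArithmeticFunction.abs_moebius_le_one
  have h' : |((ArithmeticFunction.moebius n : ℤ) : ℝ)| ≤ 1 := by exact_mod_cast h
  rw [abs_mul]
  norm_num
  linarith

theorem c2_abs_le (k : ℕ) : |c2 k| ≤ 1/4 := by
  unfold c2 chi4
  split_ifs <;> norm_num [abs_le]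

theorem c3_abs_le (k : ℕ) : |c3 k| ≤ 1/3 := by
  unfold c3 chi3
  split_ifs <;> norm_num [abs_le]

theorem combine_bound (k : ℕ) (x y B : ℝ) (hx : |x| ≤ B) (hy : |y| ≤ B) :
    |c2 k * x + c3 k * y| ≤ 7/12 * B := by
  have h1 : |c2 k * x| ≤ 1/4 * B := by
    rw [abs_mul]
    exact mul_le_mul (c2_abs_le k) hx (abs_nonneg _) (by norm_num)
  have h2 : |c3 k * y| ≤ 1/3 * B := by
    rw [abs_mul]
    exact mul_le_mul (c3_abs_le k) hy (abs_nonneg _) (by norm_num)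
  have := abs_add_le (c2 k * x) (c3 k * y)
  linarith

theorem nu23_bounds (k : ℕ) (hk2 : 2 ≤ k) (hk : Even k) (N : ℕ) (hN : 1 ≤ N) :
    |c2 k * nu2Full N + c3 k * nu3Full N| ≤ 7/12 * (2:ℝ)^(omega N) ∧
    |c2 k * nu2New N + c3 k * nu3New N| ≤ 7/12 * (2:ℝ)^(omega N) ∧
    |c2 k * nu2Min N + c3 k * nu3Min N| ≤ 7/12 * (2:ℝ)^(omega N) := by
  refine ⟨combine_bound k _ _ _ (mval_abs_le _ ?_ N) (mval_abs_le _ ?_ N),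
    combine_bound k _ _ _ (mval_abs_le _ ?_ N) (mval_abs_le _ ?_ N),
    combine_bound k _ _ _ (mval_abs_le _ ?_ N) (mval_abs_le _ ?_ N)⟩ <;>
  · intro p e
    split_ifs <;> first | exact abs_two_moebius_le _ | norm_num
end

section
/- For every integer N ≥ 1, ψ^min(N) ≥ φ(N)² / (2^{ω(N)}·N), where φ is Euler's totient function and ω(N) is the number of distinct prime divisors of N. -/
theorem local_bound (p e : ℕ) (hp : 2 ≤ p) (he : 1 ≤ e) :
    (((p^(e-1)*(p-1) : ℕ) : ℝ))^2 / (2 * (p:ℝ)^e) ≤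
    ((p:ℝ)-1)/((Nat.gcd (Nat.gcd 2 (p-1)) e : ℕ) : ℝ)
    * (if e = 1 then 1 else if e = 2 then (p:ℝ)-1 else (p:ℝ)^(e-3)*((p:ℝ)^2-1)) := by
  have hg2 : Nat.gcd (Nat.gcd 2 (p-1)) e ≤ 2 :=
    (Nat.gcd_le_left _ (Nat.gcd_pos_of_pos_left _ (by norm_num))).trans
      (Nat.gcd_le_left _ (by norm_num))
  have hg1 : 0 < Nat.gcd (Nat.gcd 2 (p-1)) e := Nat.gcd_pos_of_pos_right _ he
  generalize Nat.gcd (Nat.gcd 2 (p-1)) e = g at *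
  have hg2' : (g:ℝ) ≤ 2 := by exact_mod_cast hg2
  have hg1' : (0:ℝ) < g := by exact_mod_cast hg1
  have hp' : (2:ℝ) ≤ p := by exact_mod_cast hp
  rw [Nat.cast_mul, Nat.cast_pow, Nat.cast_sub (by omega), Nat.cast_one]
  generalize (p:ℝ) = x at *
  have hx : 0 < x := by linarith
  have hx1 : 0 ≤ x - 1 := by linarith
  have key : (x-1)/2 ≤ (x-1)/g := by gcongr
  have hX : (0:ℝ) ≤ (if e = 1 then 1 else if e = 2 then x-1 else x^(e-3)*(x^2-1)) := by
    split_ifs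
    · norm_num
    · exact hx1
    · have : 0 ≤ x^2-1 := by nlinarith
      positivity
  refine le_trans ?_ (mul_le_mul_of_nonneg_right key hX)
  rw [div_le_iff₀ (by positivity)]
  obtain rfl | rfl | h3 : e = 1 ∨ e = 2 ∨ 3 ≤ e := by omega
  · norm_num
    nlinarith
  · norm_num
    apply le_of_eq; ring
  · obtain ⟨k, rfl⟩ := Nat.exists_eq_add_of_le' h3
    rw [if_neg (by omega), if_neg (by omega)]
    simp only [Nat.add_sub_cancel, show k + 3 - 1 = k + 2 by omega]
    have : (x-1)/2*(x^k*(x^2-1))*(2*x^(k+3)) - (x^(k+2)*(x-1))^2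
        = (x^k)^2*x^3*(x-1)^2 := by ring
    have h : 0 ≤ (x^k)^2*x^3*(x-1)^2 := by positivity
    linarith

theorem psiMin_lower (N : ℕ) (hN : 1 ≤ N) :
    (Nat.totient N : ℝ)^2 / ((2:ℝ)^(omega N) * N) ≤ psiMin N := by
  have h0 : N ≠ 0 := by omega
  have hφ : (Nat.totient N : ℝ) = ∏ p ∈ N.primeFactors,
      ((p^(N.factorization p-1)*(p-1) : ℕ) : ℝ) := by
    rw [Nat.totient_eq_prod_factorization h0, Finsupp.prod, Nat.support_factorization,
      Nat.cast_prod]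
  have hNN : (N : ℝ) = ∏ p ∈ N.primeFactors, (p:ℝ)^(N.factorization p) := by
    conv_lhs => rw [← Nat.prod_factorization_pow_eq_self h0]
    rw [Finsupp.prod, Nat.support_factorization, Nat.cast_prod]
    simp
  have h2 : (2:ℝ)^(omega N) = ∏ p ∈ N.primeFactors, (2:ℝ) := by
    simp [omega]
  have e : (Nat.totient N : ℝ)^2 / ((2:ℝ)^(omega N) * N) = ∏ p ∈ N.primeFactors,
      (((p^(N.factorization p-1)*(p-1) : ℕ) : ℝ))^2 / (2 * (p:ℝ)^(N.factorization p)) := by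
    rw [Finset.prod_div_distrib, Finset.prod_mul_distrib, Finset.prod_pow, ← hφ, ← hNN, ← h2]
  rw [e, psiMin, mval]
  refine Finset.prod_le_prod (fun p _ => by positivity) fun p hp => ?_
  have hpp := Nat.prime_of_mem_primeFactors hp
  exact local_bound p _ hpp.two_le
    (hpp.factorization_pos_of_dvd h0 (Nat.dvd_of_mem_primeFactors hp))
end

section
/- For each ⋆ ∈ {full, new, min} there is a constant B > 0 such that for all real x ≥ 2, Σ_{N squarefull, N > x} 1/ψ^⋆(N) ≤ B·(log x)/√x, the sum being over squarefull integers N > x. -/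
section SqfAux
open Finset ArithmeticFunction

noncomputable def sqLoc (f : ℕ → ℕ → ℝ) : ArithmeticFunction ℝ :=
  ⟨fun n => if n = 0 then 0 else mval f n, by simp⟩

lemma sqLoc_apply (f : ℕ → ℕ → ℝ) {n : ℕ} (hn : n ≠ 0) : sqLoc f n = mval f n := by
  simp [sqLoc, hn]

lemma sqLoc_mult (f : ℕ → ℕ → ℝ) : (sqLoc f).IsMultiplicative := by
  rw [IsMultiplicative.iff_ne_zero]
  refine ⟨by simp [sqLoc, mval], ?_⟩
  intro m n hm hn h
  rw [sqLoc_apply f (mul_ne_zero hm hn), sqLoc_apply f hm, sqLoc_apply f hn]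
  unfold mval
  rw [Nat.Coprime.primeFactors_mul h, Finset.prod_union h.disjoint_primeFactors]
  congr 1
  · apply Finset.prod_congr rfl
    intro p hp
    rw [Nat.factorization_eq_of_coprime_left h]
    simpa using hp
  · apply Finset.prod_congr rfl
    intro p hp
    rw [Nat.factorization_eq_of_coprime_right h]
    simpa using hp

lemma sqLoc_prime_pow (f : ℕ → ℕ → ℝ) {p e : ℕ} (hp : p.Prime) (he : e ≠ 0) :
    sqLoc f (p ^ e) = f p e := by
  rw [sqLoc_apply f (pow_ne_zero _ hp.ne_zero)]
  unfold mval
  rw [Nat.primeFactors_prime_pow he hp]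
  simp [hp.factorization_self]

noncomputable def sqH : ArithmeticFunction ℝ := sqLoc fun p e =>
  if e < 2 then 0 else if e = 2 then 16 / (p:ℝ)^3 else 16 / (p:ℝ)^e

open Classical in
noncomputable def sqA : ArithmeticFunction ℝ :=
  ⟨fun n => if IsSquare n then 1 / (n:ℝ) else 0, by simp⟩

lemma sqA_sq (n : ℕ) : sqA (n ^ 2) = 1 / (n:ℝ)^2 := by
  have h : IsSquare (n ^ 2) := ⟨n, by ring⟩
  simp [sqA, h]

lemma sqA_nonneg (n : ℕ) : 0 ≤ sqA n := by
  simp only [sqA, coe_mk]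
  split_ifs <;> positivity

lemma sqA_mult : sqA.IsMultiplicative := by
  rw [IsMultiplicative.iff_ne_zero]
  refine ⟨by simp [sqA], ?_⟩
  intro m n hm hn h
  have key : IsSquare (m * n) ↔ IsSquare m ∧ IsSquare n := by
    constructor
    · rintro ⟨r, hr⟩
      have h1 : m * n = r ^ 2 := by rw [hr]; ring
      constructor
      · obtain ⟨d, hd⟩ := exists_eq_pow_of_mul_eq_pow (Nat.isUnit_iff.2 h) h1
        exact ⟨d, by rw [hd]; ring⟩
      · obtain ⟨d, hd⟩ := exists_eq_pow_of_mul_eq_pow (Nat.isUnit_iff.2 h.symm) ((mul_comm n m).trans h1)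
        exact ⟨d, by rw [hd]; ring⟩
    · rintro ⟨h1, h2⟩
      exact h1.mul h2
  simp only [sqA, coe_mk, key]
  by_cases h1 : IsSquare m <;> by_cases h2 : IsSquare n <;> simp [h1, h2, mul_comm]

lemma sqH_nonneg (n : ℕ) : 0 ≤ sqH n := by
  simp only [sqH, sqLoc, coe_mk, mval]
  split_ifs
  · exact le_rfl
  · apply Finset.prod_nonneg
    intro p _
    split_ifs <;> positivity

/-- majorant -/
noncomputable def sqF : ArithmeticFunction ℝ := sqA * sqA * sqH

lemma sqF_mult : sqF.IsMultiplicative := (sqA_mult.mul sqA_mult).mul (sqLoc_mult _)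

lemma sqAA_nonneg (n : ℕ) : 0 ≤ (sqA * sqA) n := by
  rw [mul_apply]
  exact Finset.sum_nonneg fun x _ => mul_nonneg (sqA_nonneg _) (sqA_nonneg _)

lemma sqF_nonneg (n : ℕ) : 0 ≤ sqF n := by
  rw [sqF, mul_apply]
  exact Finset.sum_nonneg fun x _ => mul_nonneg (sqAA_nonneg _) (sqH_nonneg _)

lemma sqA_one : sqA 1 = 1 := sqA_mult.1

lemma sqH_one : sqH 1 = 1 := (sqLoc_mult _).1

lemma conv_pow (f g : ArithmeticFunction ℝ) {p : ℕ} (hp : p.Prime) (e : ℕ) :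
    (f * g) (p ^ e) = ∑ x ∈ Finset.range (e+1), f (p ^ x) * g (p ^ (e - x)) := by
  rw [mul_apply, Nat.sum_divisorsAntidiagonal (fun a b => f a * g b), Nat.sum_divisors_prime_pow hp]
  apply Finset.sum_congr rfl
  intro x hx
  rw [Nat.pow_div (by simp at hx; omega) hp.pos]

lemma sqF_pow_two {p : ℕ} (hp : p.Prime) : 2 / (p:ℝ)^2 + 16 / (p:ℝ)^3 ≤ sqF (p ^ 2) := by
  have h1 : 2 / (p:ℝ)^2 ≤ (sqA * sqA) (p ^ 2) := by
    rw [conv_pow _ _ hp]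
    simp only [Finset.sum_range_succ, Finset.sum_range_zero]
    have := mul_nonneg (sqA_nonneg (p^1)) (sqA_nonneg (p ^ (2-1)))
    simp only [pow_zero, Nat.sub_zero, Nat.sub_self, sqA_one, sqA_sq]
    have e : 2 / (p:ℝ)^2 = 1/(p:ℝ)^2 + 1/(p:ℝ)^2 := by ring
    linarith
  have hH : sqH (p^2) = 16 / (p:ℝ)^3 := by
    rw [sqH, sqLoc_prime_pow _ hp (by omega)]; simp
  rw [sqF, conv_pow _ _ hp]
  simp only [Finset.sum_range_succ, Finset.sum_range_zero]
  have h3 : (sqA * sqA) 1 = 1 := (sqA_mult.mul sqA_mult).1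
  have := mul_nonneg (sqAA_nonneg (p^1)) (sqH_nonneg (p ^ (2-1)))
  simp only [pow_zero, Nat.sub_zero, Nat.sub_self, sqH_one, hH, h3]
  linarith

lemma sqF_pow {p e : ℕ} (hp : p.Prime) (he : 3 ≤ e) : 16 / (p:ℝ)^e ≤ sqF (p ^ e) := by
  have hH : sqH (p^e) = 16 / (p:ℝ)^e := by
    rw [sqH, sqLoc_prime_pow _ hp (by omega)]
    rw [if_neg (by omega), if_neg (by omega)]
  have h3 : (sqA * sqA) 1 = 1 := (sqA_mult.mul sqA_mult).1
  rw [sqF, conv_pow _ _ hp]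
  have := Finset.single_le_sum (f := fun x => (sqA * sqA) (p ^ x) * sqH (p ^ (e - x)))
    (s := Finset.range (e+1)) (fun x _ => mul_nonneg (sqAA_nonneg _) (sqH_nonneg _))
    (Finset.mem_range.2 (Nat.succ_pos e))
  simpa [h3, hH] using this

/-- pointwise majorization -/
lemma mval_le_sqF (f : ℕ → ℕ → ℝ)
    (hpos : ∀ p e : ℕ, p.Prime → 2 ≤ e → 0 ≤ f p e)
    (h2 : ∀ p : ℕ, p.Prime → 1 / f p 2 ≤ 2 / (p:ℝ)^2 + 16 / (p:ℝ)^3)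
    (h3 : ∀ p e : ℕ, p.Prime → 3 ≤ e → 1 / f p e ≤ 16 / (p:ℝ)^e)
    {N : ℕ} (hN : N ≠ 0) (hs : Squarefull N) : 0 ≤ 1 / mval f N ∧ 1 / mval f N ≤ sqF N := by
  have hfac : ∀ p ∈ N.primeFactors, p.Prime ∧ 2 ≤ N.factorization p := by
    intro p hp
    have hpp := Nat.prime_of_mem_primeFactors hp
    exact ⟨hpp, (hpp.pow_dvd_iff_le_factorization hN).1
      (hs p hpp (Nat.dvd_of_mem_primeFactors hp))⟩
  constructor
  · unfold mval
    exact one_div_nonneg.2 (Finset.prod_nonneg fun p hp =>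
      hpos _ _ (hfac p hp).1 (hfac p hp).2)
  · rw [IsMultiplicative.multiplicative_factorization _ sqF_mult hN]
    unfold mval Finsupp.prod
    rw [Nat.support_factorization, one_div, ← Finset.prod_inv_distrib]
    apply Finset.prod_le_prod
    · intro p hp
      exact inv_nonneg.2 (hpos _ _ (hfac p hp).1 (hfac p hp).2)
    · intro p hp
      obtain ⟨hpp, he⟩ := hfac p hp
      rw [← one_div]
      rcases he.eq_or_lt with h | h
      · rw [← h]
        exact (h2 p hpp).trans (sqF_pow_two hpp)
      · exact (h3 p _ hpp h).trans (sqF_pow hpp h)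

lemma conv_tail (f g : ArithmeticFunction ℝ) (hf : ∀ n, 0 ≤ f n) (hg : ∀ n, 0 ≤ g n)
    (M : ℕ) (z : ℝ) :
    ∑ k ∈ (Icc 1 M).filter (fun k : ℕ => z < (k:ℝ)), (f * g) k ≤
      ∑ a ∈ Icc 1 M, f a * ∑ b ∈ (Icc 1 M).filter (fun b : ℕ => z / (a:ℝ) < (b:ℝ)), g b := by
  have h1 : ∀ k ∈ (Icc 1 M).filter (fun k : ℕ => z < (k:ℝ)), (f * g) k =
      ∑ x ∈ Icc 1 M ×ˢ Icc 1 M, if x.1 * x.2 = k then f x.1 * g x.2 else 0 := by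
    intro k hk
    simp only [mem_filter, mem_Icc] at hk
    rw [mul_apply, ← Finset.sum_filter]
    apply Finset.sum_congr _ (fun _ _ => rfl)
    ext ⟨a, b⟩
    simp only [Nat.mem_divisorsAntidiagonal, mem_filter, mem_product, mem_Icc]
    constructor
    · rintro ⟨h, h0⟩
      have ha : 0 < a := Nat.pos_of_ne_zero (by rintro rfl; simp at h; omega)
      have hb : 0 < b := Nat.pos_of_ne_zero (by rintro rfl; simp at h; omega)
      refine ⟨⟨⟨ha, ?_⟩, hb, ?_⟩, h⟩ <;> nlinarith
    · rintro ⟨_, h⟩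
      exact ⟨h, by omega⟩
  rw [Finset.sum_congr rfl h1, Finset.sum_comm]
  simp_rw [Finset.mul_sum, Finset.sum_filter]
  rw [Finset.sum_product]
  apply Finset.sum_le_sum
  intro a ha
  apply Finset.sum_le_sum
  intro b hb
  simp only [mem_Icc] at ha hb
  have hfg := mul_nonneg (hf a) (hg b)
  have ha' : (0:ℝ) < a := by exact_mod_cast ha.1
  split_ifs with h
  · rw [← Finset.sum_filter, Finset.sum_ite_eq]
    split_ifs <;> simp_all
  · apply le_of_eq
    apply Finset.sum_eq_zero
    intro k hk
    split_ifs with h2 h3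
    · exfalso
      apply h
      rw [div_lt_iff₀ ha']
      rw [← h3] at h2
      push_cast at h2
      linarith
    · rfl
    · rfl

lemma sum_sqA (M : ℕ) (P : ℕ → Prop) [DecidablePred P] (φ : ℕ → ℝ) (hφ : ∀ n, 0 ≤ φ n) :
    ∑ b ∈ (Icc 1 M).filter P, sqA b * φ b ≤
      ∑ n ∈ (Icc 1 M).filter (fun n => P (n ^ 2)), 1 / (n:ℝ)^2 * φ (n ^ 2) := by
  have hinj : Set.InjOn (fun n : ℕ => n ^ 2)
      (((Icc 1 M).filter (fun n => P (n ^ 2)) : Finset ℕ) : Set ℕ) :=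
    fun a _ b _ h => Nat.pow_left_injective (n := 2) (by omega) h
  calc _ ≤ ∑ b ∈ ((Icc 1 M).filter (fun n => P (n ^ 2))).image (fun n => n ^ 2),
          sqA b * φ b := by
        have h0 : ∑ b ∈ (Icc 1 M).filter P, sqA b * φ b =
            ∑ b ∈ ((Icc 1 M).filter P) with b ∈ ((Icc 1 M).filter (fun n => P (n ^ 2))).image
              (fun n => n ^ 2), sqA b * φ b := by
          symm
          apply Finset.sum_filter_of_ne
          intro b hb hne
          have hsq : IsSquare b := by
            by_contra hc
            simp [sqA, hc] at hne
          obtain ⟨r, rfl⟩ := hsq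
          simp only [mem_filter, mem_Icc] at hb
          rw [Finset.mem_image]
          refine ⟨r, ?_, by ring⟩
          simp only [mem_filter, mem_Icc]
          have hr : 0 < r := Nat.pos_of_ne_zero (by rintro rfl; simp at hb)
          refine ⟨⟨hr, by nlinarith⟩, ?_⟩
          rw [pow_two]; exact hb.2
        rw [h0]
        apply Finset.sum_le_sum_of_subset_of_nonneg
        · intro b hb
          exact (mem_filter.1 hb).2
        · intro b _ _
          exact mul_nonneg (sqA_nonneg _) (hφ _)
    _ = _ := by
        rw [Finset.sum_image hinj]
        apply Finset.sum_congr rfl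
        intro n _
        rw [sqA_sq]

lemma tail_inv_sq (M k : ℕ) (P : ℕ → Prop) [DecidablePred P] (hP : ∀ n, 1 ≤ n → P n → k < n) :
    ∑ n ∈ (Icc 1 M).filter P, 1 / (n:ℝ)^2 ≤ 2 / ((k:ℝ) + 1) := by
  refine le_trans ?_ (sum_Ioo_inv_sq_le (α := ℝ) k (M+1))
  simp_rw [one_div]
  apply Finset.sum_le_sum_of_subset_of_nonneg
  · intro n hn
    simp only [mem_filter, mem_Icc, mem_Ioo] at hn ⊢
    exact ⟨hP n hn.1.1 hn.2, by omega⟩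
  · intro n _ _
    positivity

lemma tailA (M : ℕ) (z : ℝ) : ∑ b ∈ (Icc 1 M).filter (fun b : ℕ => z < (b:ℝ)), sqA b ≤ 2 := by
  have h := sum_sqA M (fun b : ℕ => z < (b:ℝ)) (fun _ => 1) (fun _ => by norm_num)
  simp only [mul_one] at h
  refine h.trans ((tail_inv_sq M 0 _ (fun n hn _ => hn)).trans (by norm_num))

lemma tailA' (M : ℕ) (z : ℝ) (hz : 0 < z) :
    ∑ b ∈ (Icc 1 M).filter (fun b : ℕ => z < (b:ℝ)), sqA b ≤ 2 / √z := by
  have h := sum_sqA M (fun b : ℕ => z < (b:ℝ)) (fun _ => 1) (fun _ => by norm_num)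
  simp only [mul_one] at h
  refine h.trans ((tail_inv_sq M ⌊√z⌋₊ _ (fun n hn h => ?_)).trans ?_)
  · rw [Nat.floor_lt (Real.sqrt_nonneg z), Real.sqrt_lt' (by exact_mod_cast hn)]
    exact_mod_cast h
  · have := Nat.lt_floor_add_one (√z)
    have hz' := Real.sqrt_pos.2 hz
    gcongr

lemma tailAA (M : ℕ) (x z : ℝ) (hx : 2 ≤ x) (hz : 0 < z) (hzx : z ≤ x) :
    ∑ k ∈ (Icc 1 M).filter (fun k : ℕ => z < (k:ℝ)), (sqA * sqA) k ≤ (6 + Real.log x) / √z := by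
  have hlogx : 0 ≤ Real.log x := Real.log_nonneg (by linarith)
  have hsz := Real.sqrt_pos.2 hz
  refine (conv_tail sqA sqA sqA_nonneg sqA_nonneg M z).trans ?_
  rcases lt_or_ge z 1 with hz1 | hz1
  · calc _ ≤ ∑ a ∈ Icc 1 M, sqA a * 2 := by
          apply Finset.sum_le_sum
          intro a _
          exact mul_le_mul_of_nonneg_left (tailA M _) (sqA_nonneg a)
      _ ≤ 4 := by
          rw [← Finset.sum_mul]
          have := tailA M 0
          rw [Finset.filter_true_of_mem] at this
          · linarith
          · intro a ha
            simp only [mem_Icc] at ha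
            exact_mod_cast ha.1
      _ ≤ (6 + Real.log x) / √z := by
          rw [le_div_iff₀ hsz]
          have : √z ≤ 1 := Real.sqrt_le_one.2 hz1.le
          nlinarith
  · rw [← Finset.sum_filter_add_sum_filter_not (Icc 1 M) (fun a : ℕ => z < (a:ℝ))]
    have hA : ∑ a ∈ (Icc 1 M).filter (fun a : ℕ => z < (a:ℝ)), sqA a *
        ∑ b ∈ (Icc 1 M).filter (fun b : ℕ => z / (a:ℝ) < (b:ℝ)), sqA b ≤ 4 / √z := by
      calc _ ≤ ∑ a ∈ (Icc 1 M).filter (fun a : ℕ => z < (a:ℝ)), sqA a * 2 := by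
            apply Finset.sum_le_sum
            intro a _
            exact mul_le_mul_of_nonneg_left (tailA M _) (sqA_nonneg a)
        _ ≤ _ := by
            rw [← Finset.sum_mul]
            have := tailA' M z hz
            have e : 4 / √z = 2 / √z * 2 := by ring
            rw [e]
            linarith
    have hB : ∑ a ∈ (Icc 1 M).filter (fun a : ℕ => ¬ z < (a:ℝ)), sqA a *
        ∑ b ∈ (Icc 1 M).filter (fun b : ℕ => z / (a:ℝ) < (b:ℝ)), sqA b
          ≤ (2 + Real.log x) / √z := by
      calc _ ≤ ∑ a ∈ (Icc 1 M).filter (fun a : ℕ => ¬ z < (a:ℝ)), sqA a *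
                (2 * √(a:ℝ) / √z) := by
            apply Finset.sum_le_sum
            intro a ha
            simp only [mem_filter, mem_Icc] at ha
            have ha0 : (0:ℝ) < a := by exact_mod_cast ha.1.1
            refine mul_le_mul_of_nonneg_left ((tailA' M _ (by positivity)).trans ?_) (sqA_nonneg a)
            rw [Real.sqrt_div hz.le, div_div_eq_mul_div]
        _ ≤ _ := sum_sqA M _ _ (fun n => by positivity)
        _ = (2 / √z) * ∑ n ∈ (Icc 1 M).filter (fun n : ℕ => ¬ z < ((n^2 : ℕ):ℝ)), (n:ℝ)⁻¹ := by
            rw [Finset.mul_sum]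
            apply Finset.sum_congr rfl
            intro n hn
            simp only [mem_filter, mem_Icc] at hn
            have hn0 : (0:ℝ) < n := by exact_mod_cast hn.1.1
            push_cast
            rw [Real.sqrt_sq hn0.le]
            field_simp
        _ ≤ (2 / √z) * ∑ n ∈ Icc 1 ⌊√z⌋₊, (n:ℝ)⁻¹ := by
            apply mul_le_mul_of_nonneg_left _ (by positivity)
            apply Finset.sum_le_sum_of_subset_of_nonneg
            · intro n hn
              simp only [mem_filter, mem_Icc, not_lt] at hn ⊢
              refine ⟨hn.1.1, Nat.le_floor ?_⟩
              apply Real.le_sqrt_of_sq_le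
              exact_mod_cast hn.2
            · intro n _ _
              positivity
        _ ≤ (2 / √z) * (1 + Real.log √z) := by
            apply mul_le_mul_of_nonneg_left _ (by positivity)
            have h1 := harmonic_floor_le_one_add_log (√z) (Real.one_le_sqrt.2 hz1)
            rw [harmonic_eq_sum_Icc] at h1
            push_cast at h1
            exact h1
        _ ≤ _ := by
            rw [Real.log_sqrt hz.le]
            have : Real.log z ≤ Real.log x := Real.log_le_log hz hzx
            rw [div_mul_eq_mul_div]
            gcongr
            linarith
    have e : (6 + Real.log x) / √z = 4 / √z + (2 + Real.log x) / √z := by ring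
    rw [e]
    exact add_le_add hA hB

lemma sqH_sum_prime {p : ℕ} (hp : p.Prime) :
    Summable (fun n : ℕ => √((p ^ n : ℕ) : ℝ) * sqH (p ^ n)) ∧
    ∑' n : ℕ, √((p ^ n : ℕ) : ℝ) * sqH (p ^ n) ≤ 1 + 80 * (1 / (p:ℝ) ^ (3/2 : ℝ)) := by
  set r : ℝ := 1 / √(p:ℝ) with hr
  have hp0 : (0:ℝ) < p := by exact_mod_cast hp.pos
  have hp2 : (2:ℝ) ≤ p := by exact_mod_cast hp.two_le
  have hsp := Real.sqrt_pos.2 hp0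
  have hss := Real.sq_sqrt hp0.le
  have hr0 : 0 < r := by positivity
  have hr1 : r ≤ 3/4 := by
    rw [hr, div_le_iff₀ hsp]
    have : (4/3:ℝ) ≤ √(p:ℝ) := Real.le_sqrt_of_sq_le (by norm_num; linarith)
    linarith
  have hr2 : r ^ 2 = 1 / p := by rw [hr, div_pow, hss, one_pow]
  have hr3 : r ^ 3 = 1 / (p:ℝ) ^ (3/2 : ℝ) := by
    rw [hr, div_pow, one_pow, Real.sqrt_eq_rpow, ← Real.rpow_natCast, ← Real.rpow_mul hp0.le]
    norm_num
  have hs : ∀ n : ℕ, √((p ^ n : ℕ) : ℝ) = √(p:ℝ) ^ n := by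
    intro n
    push_cast
    rw [Real.sqrt_eq_iff_mul_self_eq (by positivity) (by positivity), ← mul_pow,
      Real.mul_self_sqrt hp0.le]
  have ht : ∀ n : ℕ, √((p ^ (n+3) : ℕ) : ℝ) * sqH (p ^ (n+3)) = 16 * r ^ 3 * r ^ n := by
    intro n
    rw [hs, sqH, sqLoc_prime_pow _ hp (by omega), if_neg (by omega), if_neg (by omega)]
    rw [mul_assoc, ← pow_add, add_comm 3 n, hr, div_pow, one_pow]
    have : (p:ℝ)^(n+3) = √(p:ℝ)^(n+3) * √(p:ℝ)^(n+3) := by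
      rw [← mul_pow, Real.mul_self_sqrt hp0.le]
    rw [this]
    field_simp
  have hgeo := (hasSum_geometric_of_lt_one hr0.le (by linarith)).mul_left (16 * r^3)
  have hsum : Summable (fun n : ℕ => √((p ^ n : ℕ) : ℝ) * sqH (p ^ n)) := by
    rw [← summable_nat_add_iff 3]
    simp_rw [ht]
    exact hgeo.summable
  refine ⟨hsum, ?_⟩
  rw [← hsum.sum_add_tsum_nat_add 3]
  simp_rw [ht]
  rw [hgeo.tsum_eq, ← hr3]
  have e0 : √((p ^ 0 : ℕ) : ℝ) * sqH (p ^ 0) = 1 := by simp [sqH_one]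
  have e1 : √((p ^ 1 : ℕ) : ℝ) * sqH (p ^ 1) = 0 := by
    rw [sqH, sqLoc_prime_pow _ hp (by omega)]; simp
  have e2 : √((p ^ 2 : ℕ) : ℝ) * sqH (p ^ 2) ≤ 16 * r^3 := by
    rw [hs, sqH, sqLoc_prime_pow _ hp (by omega), hss]
    simp only [lt_irrefl, if_false, if_true]
    have : (p:ℝ) * (16 / (p:ℝ)^3) = 16 * (r^3 * r) := by
      rw [← pow_succ, show r^(3+1) = (r^2)^2 by ring, hr2]
      field_simp
    rw [this]
    have : 0 < r^3 := by positivity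
    nlinarith
  simp only [Finset.sum_range_succ, Finset.sum_range_zero, e0, e1]
  have : (1 - r)⁻¹ ≤ 4 := by
    rw [inv_le_comm₀ (by linarith) (by norm_num)]
    linarith
  have h3 : 0 < r^3 := by positivity
  nlinarith

lemma sqH_sum : ∃ K : ℝ, 0 < K ∧ ∀ M : ℕ, ∑ w ∈ Icc 1 M, √(w:ℝ) * sqH w ≤ K := by
  have hS : Summable (fun n : ℕ => 80 * (1 / (n:ℝ) ^ (3/2 : ℝ))) :=
    (Real.summable_one_div_nat_rpow.2 (by norm_num)).mul_left 80
  refine ⟨Real.exp (∑' n : ℕ, 80 * (1 / (n:ℝ) ^ (3/2 : ℝ))), Real.exp_pos _, fun M => ?_⟩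
  have hnn : ∀ n : ℕ, 0 ≤ √(n:ℝ) * sqH n := fun n => mul_nonneg (Real.sqrt_nonneg _) (sqH_nonneg n)
  have hE := EulerProduct.summable_and_hasSum_factoredNumbers_prod_filter_prime_tsum
    (f := fun n : ℕ => √(n:ℝ) * sqH n) (by simp [sqH_one])
    (by
      intro m n h
      have : sqH (m * n) = sqH m * sqH n := (sqLoc_mult _).2 h
      simp only [this]
      push_cast
      rw [Real.sqrt_mul (by positivity)]
      ring)
    (by
      intro p hp
      simp_rw [Real.norm_of_nonneg (hnn _)]
      exact (sqH_sum_prime hp).1) (Finset.range (M+1))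
  have hmem : ∀ w ∈ Icc 1 M, w ∈ Nat.factoredNumbers (Finset.range (M+1)) := by
    intro w hw
    simp only [mem_Icc] at hw
    rw [Nat.mem_factoredNumbers_iff_forall_le]
    refine ⟨by omega, fun p hp _ _ => ?_⟩
    simp; omega
  have h1 : ∑ w ∈ Icc 1 M, √(w:ℝ) * sqH w ≤
      ∏ p ∈ (Finset.range (M+1)) with p.Prime, ∑' n : ℕ, √((p ^ n : ℕ) : ℝ) * sqH (p ^ n) := by
    rw [← Finset.sum_coe_sort]
    have hinj : Function.Injective (fun w : {w // w ∈ Icc 1 M} =>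
        (⟨w.1, hmem w.1 w.2⟩ : Nat.factoredNumbers (Finset.range (M+1)))) := by
      intro a b h
      apply Subtype.ext
      exact congrArg (fun t : Nat.factoredNumbers (Finset.range (M+1)) => t.1) h
    have := sum_le_hasSum (Finset.univ.map ⟨_, hinj⟩) (fun i _ => hnn i.1) hE.2
    rw [Finset.sum_map] at this
    exact this
  refine h1.trans ?_
  calc _ ≤ ∏ p ∈ (Finset.range (M+1)) with p.Prime, (1 + 80 * (1 / (p:ℝ) ^ (3/2 : ℝ))) := by
        apply Finset.prod_le_prod
        · intro p _
          exact tsum_nonneg fun n => hnn _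
        · intro p hp
          exact (sqH_sum_prime (mem_filter.1 hp).2).2
    _ ≤ _ := Real.prod_one_add_le_exp_sum _ (fun i => by positivity)
    _ ≤ _ := by
        apply Real.exp_le_exp.2
        exact hS.sum_le_tsum _ (fun i _ => by positivity)

lemma tailF : ∃ B : ℝ, 0 < B ∧ ∀ x : ℝ, 2 ≤ x → ∀ M : ℕ,
    ∑ k ∈ (Icc 1 M).filter (fun k : ℕ => x < (k:ℝ)), sqF k ≤ B * Real.log x / √x := by
  obtain ⟨K, hK, h⟩ := sqH_sum
  refine ⟨K * 13, by positivity, fun x hx M => ?_⟩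
  have hlog : 1/2 ≤ Real.log x := by
    have h1 := Real.log_two_gt_d9
    have h2 := Real.log_le_log (by norm_num) hx
    norm_num at h1
    linarith
  have hsx : 0 < √x := Real.sqrt_pos.2 (by linarith)
  rw [sqF, mul_comm (sqA * sqA) sqH]
  refine (conv_tail sqH (sqA * sqA) sqH_nonneg sqAA_nonneg M x).trans ?_
  calc _ ≤ ∑ w ∈ Icc 1 M, ((6 + Real.log x) / √x) * (√(w:ℝ) * sqH w) := by
        apply Finset.sum_le_sum
        intro w hw
        simp only [mem_Icc] at hw
        have hw1 : (1:ℝ) ≤ w := by exact_mod_cast hw.1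
        have := tailAA M x (x / w) hx (by positivity) (div_le_self (by linarith) hw1)
        refine (mul_le_mul_of_nonneg_left this (sqH_nonneg w)).trans (le_of_eq ?_)
        rw [Real.sqrt_div (by linarith)]
        field_simp
    _ ≤ ((6 + Real.log x) / √x) * K := by
        rw [← Finset.mul_sum]
        exact mul_le_mul_of_nonneg_left (h M) (by positivity)
    _ ≤ _ := by
        rw [div_mul_eq_mul_div]
        apply div_le_div_of_nonneg_right _ hsx.le
        nlinarith

lemma tail_of_local (f : ℕ → ℕ → ℝ)
    (hpos : ∀ p e : ℕ, p.Prime → 2 ≤ e → 0 ≤ f p e)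
    (h2 : ∀ p : ℕ, p.Prime → 1 / f p 2 ≤ 2 / (p:ℝ)^2 + 16 / (p:ℝ)^3)
    (h3 : ∀ p e : ℕ, p.Prime → 3 ≤ e → 1 / f p e ≤ 16 / (p:ℝ)^e) :
    ∃ B : ℝ, 0 < B ∧ ∀ x : ℝ, 2 ≤ x →
      (∑' N : {N : ℕ // Squarefull N ∧ x < (N:ℝ)}, 1 / mval f N.1) ≤
        B * Real.log x / Real.sqrt x := by
  obtain ⟨B, hB, h⟩ := tailF
  refine ⟨B, hB, fun x hx => ?_⟩
  have hne : ∀ N : {N : ℕ // Squarefull N ∧ x < (N:ℝ)}, N.1 ≠ 0 := by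
    rintro ⟨N, _, h⟩ h0
    simp only at h0
    rw [h0] at h
    norm_num at h
    linarith
  have hm := fun N : {N : ℕ // Squarefull N ∧ x < (N:ℝ)} =>
    mval_le_sqF f hpos h2 h3 (hne N) N.2.1
  apply Real.tsum_le_of_sum_le (fun N => (hm N).1)
  intro s
  refine (Finset.sum_le_sum fun N _ => (hm N).2).trans ?_
  refine le_trans ?_ (h x hx (s.sup fun N => N.1))
  have hmap := Finset.sum_map s (Function.Embedding.subtype _) (fun n => sqF n)
  simp only [Function.Embedding.subtype_apply] at hmap
  rw [← hmap]
  apply Finset.sum_le_sum_of_subset_of_nonneg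
  · intro n hn
    rw [Finset.mem_map] at hn
    obtain ⟨N, hN, rfl⟩ := hn
    simp only [mem_filter, mem_Icc, Function.Embedding.subtype_apply]
    exact ⟨⟨Nat.pos_of_ne_zero (hne N), Finset.le_sup (f := fun N => N.1) hN⟩, N.2.2⟩
  · intro n _ _
    exact sqF_nonneg n

lemma one_div_le_of {t c q : ℝ} (hq : 0 < q) (hc : 0 < c) (h : q ≤ c * t) : 1 / t ≤ c / q := by
  have ht : 0 < t := by
    by_contra hh
    push Not at hh
    nlinarith
  rw [div_le_div_iff₀ ht hq]
  linarith

lemma pow_split (p : ℝ) {e : ℕ} (he : 3 ≤ e) : p ^ e = p ^ (e-3) * p^3 := by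
  rw [← pow_add]; congr 1; omega

lemma sq_two_bound {p t : ℝ} (hp : 2 ≤ p) (h : (p-1)^2 ≤ 2 * t) :
    1 / t ≤ 2 / p^2 + 16 / p^3 := by
  have h1 : 1 / t ≤ 2 / (p-1)^2 := one_div_le_of (by nlinarith) (by norm_num) h
  refine h1.trans ?_
  have hp1 : 0 < p - 1 := by linarith
  have e : 2 / p^2 + 16 / p^3 = (2 * p + 16) / p^3 := by field_simp
  rw [e, div_le_div_iff₀ (by positivity) (by positivity)]
  nlinarith

lemma gcd_cast_bound (p e : ℕ) :
    (0:ℝ) < ((Nat.gcd (Nat.gcd 2 (p-1)) e : ℕ) : ℝ) ∧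
      ((Nat.gcd (Nat.gcd 2 (p-1)) e : ℕ) : ℝ) ≤ 2 := by
  have h1 : Nat.gcd 2 (p-1) ≤ 2 := Nat.gcd_le_left _ (by norm_num)
  have h0 : 0 < Nat.gcd 2 (p-1) := Nat.gcd_pos_of_pos_left _ (by norm_num)
  have h2 := Nat.gcd_le_left e h0
  have h3 := Nat.gcd_pos_of_pos_left e h0
  exact ⟨by exact_mod_cast h3, by exact_mod_cast h2.trans h1⟩

lemma sq_half {a g : ℝ} (ha : 0 ≤ a) (hg : 0 < g) (hg2 : g ≤ 2) : a / 2 ≤ a / g := by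
  gcongr

end SqfAux


theorem squarefull_psi_tail_sum :
    (∃ B : ℝ, 0 < B ∧ ∀ x : ℝ, 2 ≤ x → (∑' N : {N : ℕ // Squarefull N ∧ x < (N:ℝ)}, 1 / psiFull N.1) ≤ B * Real.log x / Real.sqrt x) ∧
    (∃ B : ℝ, 0 < B ∧ ∀ x : ℝ, 2 ≤ x → (∑' N : {N : ℕ // Squarefull N ∧ x < (N:ℝ)}, 1 / psiNew N.1) ≤ B * Real.log x / Real.sqrt x) ∧
    (∃ B : ℝ, 0 < B ∧ ∀ x : ℝ, 2 ≤ x → (∑' N : {N : ℕ // Squarefull N ∧ x < (N:ℝ)}, 1 / psiMin N.1) ≤ B * Real.log x / Real.sqrt x) := by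
  refine ⟨tail_of_local _ ?_ ?_ ?_, tail_of_local _ ?_ ?_ ?_, tail_of_local _ ?_ ?_ ?_⟩
  · intro p e hp he
    positivity
  · intro p hp
    have hp2 : (2:ℝ) ≤ p := by exact_mod_cast hp.two_le
    apply sq_two_bound hp2
    norm_num
    nlinarith
  · intro p e hp he
    have hp2 : (2:ℝ) ≤ p := by exact_mod_cast hp.two_le
    have h1 : (0:ℝ) < (p:ℝ)^e := by positivity
    have h2 : (0:ℝ) < (p:ℝ)^(e-1) := by positivity
    apply one_div_le_of h1 (by norm_num)
    linarith
  · intro p e hp he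
    have hp2 : (2:ℝ) ≤ p := by exact_mod_cast hp.two_le
    rw [if_neg (by omega)]
    split_ifs
    · nlinarith
    · positivity
  · intro p hp
    have hp2 : (2:ℝ) ≤ p := by exact_mod_cast hp.two_le
    apply sq_two_bound hp2
    norm_num
    by_cases h : p = 2
    · subst h; norm_num
    · have hp3 : (3:ℝ) ≤ p := by
        have := hp.two_le
        exact_mod_cast (by omega : 3 ≤ p)
      nlinarith
  · intro p e hp he
    have hp2 : (2:ℝ) ≤ p := by exact_mod_cast hp.two_le
    rw [if_neg (by omega), if_neg (by omega)]
    have h1 : (0:ℝ) < (p:ℝ)^(e-3) := by positivity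
    apply one_div_le_of (by positivity) (by norm_num)
    rw [pow_split (p:ℝ) he]
    have h4 : (p:ℝ)^3 ≤ 16 * (((p:ℝ)-1)^2 * ((p:ℝ)+1)) := by
      have : (p:ℝ)^2 ≤ 4 * ((p:ℝ)-1)^2 := by nlinarith
      nlinarith
    nlinarith [mul_le_mul_of_nonneg_left h4 h1.le]
  · intro p e hp he
    have hp2 : (2:ℝ) ≤ p := by exact_mod_cast hp.two_le
    have hp1 : (0:ℝ) ≤ (p:ℝ) - 1 := by linarith
    have hp3 : (0:ℝ) ≤ (p:ℝ)^2 - 1 := by nlinarith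
    rw [if_neg (by omega)]
    split_ifs <;> positivity
  · intro p hp
    have hp2 : (2:ℝ) ≤ p := by exact_mod_cast hp.two_le
    have hp1 : (0:ℝ) ≤ (p:ℝ) - 1 := by linarith
    obtain ⟨g0, g2⟩ := gcd_cast_bound p 2
    have hh := sq_half hp1 g0 g2
    apply sq_two_bound hp2
    rw [if_neg (by norm_num), if_pos rfl]
    nlinarith [mul_le_mul_of_nonneg_right hh hp1]
  · intro p e hp he
    have hp2 : (2:ℝ) ≤ p := by exact_mod_cast hp.two_le
    have hp1 : (0:ℝ) ≤ (p:ℝ) - 1 := by linarith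
    have hp3 : (0:ℝ) ≤ (p:ℝ)^2 - 1 := by nlinarith
    obtain ⟨g0, g2⟩ := gcd_cast_bound p e
    have hh := sq_half hp1 g0 g2
    rw [if_neg (by omega), if_neg (by omega)]
    have h1 : (0:ℝ) < (p:ℝ)^(e-3) := by positivity
    apply one_div_le_of (by positivity) (by norm_num)
    rw [pow_split (p:ℝ) he]
    have h4 : (p:ℝ)^3 ≤ 16 * (((p:ℝ)-1)/2 * ((p:ℝ)^2-1)) := by
      have : (p:ℝ)^2 ≤ 2 * ((p:ℝ)^2-1) := by nlinarith
      nlinarith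
    have h5 := mul_le_mul_of_nonneg_right hh (mul_nonneg h1.le hp3)
    have h6 := mul_le_mul_of_nonneg_left h4 h1.le
    linarith
end

section
/- There exists a constant B > 0 such that for every real x ≥ 1, Σ_{n ≤ x} 2^{ω(n)}·n²/φ(n)² ≤ B·x·(1 + log x), the sum being over positive integers n ≤ x. -/
noncomputable def Gsf (u : ℕ → ℝ) (d : ℕ) : ℝ := if Squarefree d then ∏ p ∈ d.primeFactors, u p else 0

lemma Gsf_nonneg (u : ℕ → ℝ) (hu : ∀ p, p.Prime → 0 ≤ u p) (d : ℕ) : 0 ≤ Gsf u d := by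
  unfold Gsf
  split_ifs
  · exact Finset.prod_nonneg fun p hp => hu p (Nat.prime_of_mem_primeFactors hp)
  · exact le_rfl

lemma lemA (u : ℕ → ℝ) (hu : ∀ p, p.Prime → 0 ≤ u p) (n : ℕ) (hn : n ≠ 0) :
    ∏ p ∈ n.primeFactors, (1 + u p) ≤ ∑ d ∈ n.divisors, Gsf u d := by
  rw [Finset.prod_one_add]
  have hpr : ∀ S ∈ n.primeFactors.powerset, ∀ p ∈ S, p.Prime := fun S hS p hp =>
    Nat.prime_of_mem_primeFactors (Finset.mem_powerset.1 hS hp)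
  have hinj : Set.InjOn (fun S : Finset ℕ => ∏ p ∈ S, p) (n.primeFactors.powerset : Set (Finset ℕ)) := by
    intro S hS T hT h
    rw [← Nat.primeFactors_prod (hpr S hS), ← Nat.primeFactors_prod (hpr T hT)]
    exact congrArg _ h
  have hsq : ∀ S ∈ n.primeFactors.powerset, Squarefree (∏ p ∈ S, p) := by
    intro S hS
    refine Finset.squarefree_prod_of_pairwise_isCoprime (fun p hp q hq hpq => ?_)
      (fun p hp => (hpr S hS p hp).squarefree)
    exact Nat.coprime_iff_isRelPrime.1
      ((Nat.coprime_primes (hpr S hS p hp) (hpr S hS q hq)).2 hpq)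
  calc ∑ S ∈ n.primeFactors.powerset, ∏ p ∈ S, u p
      = ∑ S ∈ n.primeFactors.powerset, Gsf u (∏ p ∈ S, p) := by
        refine Finset.sum_congr rfl fun S hS => ?_
        rw [Gsf, if_pos (hsq S hS), Nat.primeFactors_prod (hpr S hS)]
    _ = ∑ d ∈ n.primeFactors.powerset.image (fun S : Finset ℕ => ∏ p ∈ S, p), Gsf u d := by
        rw [Finset.sum_image hinj]
    _ ≤ _ := by
        refine Finset.sum_le_sum_of_subset_of_nonneg ?_ fun d _ _ => Gsf_nonneg u hu d
        intro d hd
        obtain ⟨S, hS, rfl⟩ := Finset.mem_image.1 hd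
        exact Nat.mem_divisors.2 ⟨(Finset.prod_dvd_prod_of_subset _ _ _ (Finset.mem_powerset.1 hS)).trans
          (Nat.prod_primeFactors_dvd n), hn⟩

lemma lemB (a w : ℕ → ℝ) (N : ℕ) :
    ∑ n ∈ Finset.Icc 1 N, w n * ∑ d ∈ n.divisors, a d
      = ∑ d ∈ Finset.Icc 1 N, a d * ∑ m ∈ Finset.Icc 1 (N / d), w (d * m) := by
  simp_rw [Finset.mul_sum]
  rw [Finset.sum_sigma', Finset.sum_sigma']
  refine Finset.sum_bij' (fun x _ => ⟨x.2, x.1 / x.2⟩) (fun y _ => ⟨y.1 * y.2, y.1⟩) ?_ ?_ ?_ ?_ ?_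
  · rintro ⟨n, d⟩ h
    simp only [Finset.mem_sigma, Finset.mem_Icc, Nat.mem_divisors] at h ⊢
    obtain ⟨⟨h1, h2⟩, h3, h4⟩ := h
    have hd := Nat.pos_of_dvd_of_pos h3 h1
    have := Nat.le_of_dvd h1 h3
    exact ⟨⟨hd, by omega⟩, Nat.div_pos this hd, Nat.div_le_div_right h2⟩
  · rintro ⟨d, m⟩ h
    simp only [Finset.mem_sigma, Finset.mem_Icc, Nat.mem_divisors] at h ⊢
    obtain ⟨⟨h1, h2⟩, h3, h4⟩ := h
    have : 0 < d * m := Nat.mul_pos h1 h3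
    refine ⟨⟨this, ?_⟩, dvd_mul_right _ _, this.ne'⟩
    rw [mul_comm]; exact (Nat.le_div_iff_mul_le h1).1 h4
  · rintro ⟨n, d⟩ h
    simp only [Finset.mem_sigma, Finset.mem_Icc, Nat.mem_divisors] at h ⊢
    rw [Nat.mul_div_cancel' h.2.1]
  · rintro ⟨d, m⟩ h
    simp only [Finset.mem_sigma, Finset.mem_Icc, Nat.mem_divisors] at h ⊢
    rw [Nat.mul_div_cancel_left _ h.1.1]
  · rintro ⟨n, d⟩ h
    simp only [Finset.mem_sigma, Finset.mem_Icc, Nat.mem_divisors] at h ⊢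
    rw [Nat.mul_div_cancel' h.2.1, mul_comm]

lemma lemC (u : ℕ → ℝ) (hu : ∀ p, p.Prime → 0 ≤ u p) (N : ℕ) :
    ∑ e ∈ Finset.Icc 1 N, Gsf u e / e
      ≤ ∏ p ∈ (Finset.Icc 1 N).filter Nat.Prime, (1 + u p / p) := by
  rw [Finset.prod_one_add]
  have h1 : ∑ e ∈ Finset.Icc 1 N, Gsf u e / e
      = ∑ e ∈ (Finset.Icc 1 N).filter Squarefree, ∏ p ∈ e.primeFactors, (u p / p) := by
    rw [Finset.sum_filter]
    refine Finset.sum_congr rfl fun e he => ?_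
    unfold Gsf
    split_ifs with h
    · rw [Finset.prod_div_distrib]
      congr 1
      conv_lhs => rw [← Nat.prod_primeFactors_of_squarefree h]
      push_cast; rfl
    · simp
  rw [h1, ← Finset.sum_image (f := fun S => ∏ p ∈ S, (u p / p)) (g := Nat.primeFactors)]
  · refine Finset.sum_le_sum_of_subset_of_nonneg ?_ ?_
    · intro S hS
      obtain ⟨e, he, rfl⟩ := Finset.mem_image.1 hS
      simp only [Finset.mem_filter, Finset.mem_Icc] at he
      refine Finset.mem_powerset.2 fun p hp => ?_
      have hp' := Nat.prime_of_mem_primeFactors hp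
      simp only [Finset.mem_filter, Finset.mem_Icc]
      exact ⟨⟨hp'.one_le, (Nat.le_of_mem_primeFactors hp).trans he.1.2⟩, hp'⟩
    · intro S hS _
      refine Finset.prod_nonneg fun p hp => ?_
      have := hu p (Finset.mem_filter.1 (Finset.mem_powerset.1 hS hp)).2
      positivity
  · intro a ha b hb h
    simp only [Finset.coe_filter, Set.mem_ofPred_eq] at ha hb
    rw [← Nat.prod_primeFactors_of_squarefree ha.2, ← Nat.prod_primeFactors_of_squarefree hb.2, h]

noncomputable def cc (p : ℕ) : ℝ := 2 * ((p:ℝ) / (p - 1)) ^ 2 - 2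

lemma cc_nonneg (p : ℕ) (hp : p.Prime) : 0 ≤ cc p := by
  have h2 : (2:ℝ) ≤ p := by exact_mod_cast hp.two_le
  have : 1 ≤ (p:ℝ) / (p - 1) := by rw [le_div_iff₀ (by linarith)]; linarith
  unfold cc
  nlinarith

lemma cc_le (p : ℕ) (hp : p.Prime) : cc p / p ≤ 12 * (1 / (p:ℝ) ^ 2) := by
  have h2 : (2:ℝ) ≤ p := by exact_mod_cast hp.two_le
  have h : cc p ≤ 12 / p := by
    unfold cc
    rw [div_pow, ← sub_nonneg]
    have : (12 / (p:ℝ)) - (2 * ((p:ℝ)^2 / ((p:ℝ) - 1)^2) - 2)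
        = 2 * ((p:ℝ) - 2) * (4 * p - 3) / (p * ((p:ℝ)-1)^2) := by
      have h0 : (p:ℝ) ≠ 0 := by linarith
      have h1 : (p:ℝ) - 1 ≠ 0 := by linarith
      field_simp
      ring
    rw [this]
    have : 0 ≤ (p:ℝ) - 2 := by linarith
    have : 0 ≤ 4 * (p:ℝ) - 3 := by linarith
    positivity
  calc cc p / p ≤ (12 / p) / p := by gcongr
    _ = _ := by field_simp

lemma term_eq (n : ℕ) (hn : n ≠ 0) :
    (2:ℝ)^(omega n) * (n:ℝ)^2 / (Nat.totient n : ℝ)^2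
      = ∏ p ∈ n.primeFactors, (1 + (1 + cc p)) := by
  have ht : (Nat.totient n : ℝ) = n * ∏ p ∈ n.primeFactors, (1 - (p:ℝ)⁻¹) := by
    have := Nat.totient_eq_mul_prod_factors n
    have := congrArg (fun q : ℚ => (q : ℝ)) this
    push_cast at this
    exact this
  have hn' : (n:ℝ) ≠ 0 := by exact_mod_cast hn
  rw [ht, mul_pow, mul_comm ((n:ℝ)^2), mul_div_mul_right _ _ (pow_ne_zero 2 hn'), omega,
    ← Finset.prod_const, ← Finset.prod_pow, ← Finset.prod_div_distrib]
  refine Finset.prod_congr rfl fun p hp => ?_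
  have h2 : (2:ℝ) ≤ p := by exact_mod_cast (Nat.prime_of_mem_primeFactors hp).two_le
  have h0 : (p:ℝ) ≠ 0 := by linarith
  have h1 : (p:ℝ) - 1 ≠ 0 := by linarith
  have h3 : 1 - (p:ℝ)⁻¹ = (p - 1) / p := by field_simp
  rw [h3, cc]
  field_simp
  ring

theorem partial_sum_bound :
    ∃ B : ℝ, 0 < B ∧ ∀ x : ℝ, 1 ≤ x →
      (∑ n ∈ Finset.Icc 1 ⌊x⌋₊, (2:ℝ)^(omega n) * (n:ℝ)^2 / (Nat.totient n : ℝ)^2)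
        ≤ B * x * (1 + Real.log x) := by
  have hs : Summable fun n : ℕ => 12 * (1 / (n:ℝ) ^ 2) :=
    (Real.summable_one_div_nat_pow.2 (by norm_num)).mul_left 12
  refine ⟨Real.exp (∑' n : ℕ, 12 * (1 / (n:ℝ) ^ 2)), Real.exp_pos _, fun x hx => ?_⟩
  set C := Real.exp (∑' n : ℕ, 12 * (1 / (n:ℝ) ^ 2)) with hC
  set N := ⌊x⌋₊ with hN
  have hu : ∀ p : ℕ, p.Prime → 0 ≤ 1 + cc p := fun p hp => by linarith [cc_nonneg p hp]
  have hNx : (N:ℝ) ≤ x := Nat.floor_le (by linarith)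
  have hharm : ∑ m ∈ Finset.Icc 1 N, ((m:ℝ))⁻¹ ≤ 1 + Real.log x := by
    have := harmonic_floor_le_one_add_log x hx
    rw [harmonic_eq_sum_Icc] at this
    push_cast at this
    exact this
  have hE : ∑ e ∈ Finset.Icc 1 N, Gsf cc e / e ≤ C := by
    refine (lemC cc cc_nonneg N).trans ?_
    calc ∏ p ∈ (Finset.Icc 1 N).filter Nat.Prime, (1 + cc p / p)
        ≤ ∏ p ∈ (Finset.Icc 1 N).filter Nat.Prime, Real.exp (12 * (1 / (p:ℝ) ^ 2)) := by
          refine Finset.prod_le_prod ?_ ?_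
          · intro p hp
            have := cc_nonneg p (Finset.mem_filter.1 hp).2
            positivity
          · intro p hp
            have := cc_le p (Finset.mem_filter.1 hp).2
            linarith [Real.add_one_le_exp (12 * (1 / (p:ℝ) ^ 2))]
      _ = Real.exp (∑ p ∈ (Finset.Icc 1 N).filter Nat.Prime, 12 * (1 / (p:ℝ) ^ 2)) :=
          (Real.exp_sum _ _).symm
      _ ≤ C := Real.exp_le_exp.2 (hs.sum_le_tsum _ fun i _ => by positivity)
  have step1 : ∑ n ∈ Finset.Icc 1 N, (2:ℝ)^(omega n) * (n:ℝ)^2 / (Nat.totient n : ℝ)^2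
      ≤ x * ∑ d ∈ Finset.Icc 1 N, (d:ℝ)⁻¹ * Gsf (fun p => 1 + cc p) d := by
    calc _ ≤ ∑ n ∈ Finset.Icc 1 N, 1 * ∑ d ∈ n.divisors, Gsf (fun p => 1 + cc p) d := by
          refine Finset.sum_le_sum fun n hn => ?_
          have hn0 : n ≠ 0 := by have := (Finset.mem_Icc.1 hn).1; omega
          rw [term_eq n hn0, one_mul]
          exact lemA (fun p => 1 + cc p) hu n hn0
      _ ≤ _ := by
          rw [lemB (Gsf (fun p => 1 + cc p)) (fun _ => 1) N, Finset.mul_sum]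
          refine Finset.sum_le_sum fun d hd => ?_
          have hg := Gsf_nonneg (fun p => 1 + cc p) hu d
          have h1 : ∑ m ∈ Finset.Icc 1 (N / d), (1:ℝ) ≤ x * (d:ℝ)⁻¹ := by
            simp only [Finset.sum_const, Nat.card_Icc, nsmul_eq_mul, mul_one, Nat.add_sub_cancel]
            refine Nat.cast_div_le.trans ?_
            rw [← div_eq_mul_inv]
            gcongr
          calc _ ≤ Gsf (fun p => 1 + cc p) d * (x * (d:ℝ)⁻¹) := by gcongr
            _ = _ := by ring
  have step2 : ∑ d ∈ Finset.Icc 1 N, (d:ℝ)⁻¹ * Gsf (fun p => 1 + cc p) d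
      ≤ C * (1 + Real.log x) := by
    calc _ ≤ ∑ d ∈ Finset.Icc 1 N, (d:ℝ)⁻¹ * ∑ e ∈ d.divisors, Gsf cc e := by
          refine Finset.sum_le_sum fun d hd => ?_
          have hd0 : d ≠ 0 := by have := (Finset.mem_Icc.1 hd).1; omega
          have := lemA cc cc_nonneg d hd0
          have hle : Gsf (fun p => 1 + cc p) d ≤ ∑ e ∈ d.divisors, Gsf cc e := by
            unfold Gsf at this ⊢
            split_ifs
            · exact this
            · exact Finset.sum_nonneg fun e _ => Gsf_nonneg cc cc_nonneg e
          gcongr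
      _ = ∑ e ∈ Finset.Icc 1 N, Gsf cc e * ∑ m ∈ Finset.Icc 1 (N / e), ((e * m : ℕ):ℝ)⁻¹ :=
          lemB (Gsf cc) (fun n => (n:ℝ)⁻¹) N
      _ ≤ ∑ e ∈ Finset.Icc 1 N, Gsf cc e / e * (1 + Real.log x) := by
          refine Finset.sum_le_sum fun e he => ?_
          have hg := Gsf_nonneg cc cc_nonneg e
          have h1 : ∑ m ∈ Finset.Icc 1 (N / e), (m:ℝ)⁻¹ ≤ 1 + Real.log x := by
            refine le_trans ?_ hharm
            exact Finset.sum_le_sum_of_subset_of_nonneg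
              (Finset.Icc_subset_Icc_right (Nat.div_le_self N e)) fun i _ _ => by positivity
          simp_rw [Nat.cast_mul, mul_inv, ← Finset.mul_sum]
          rw [← mul_assoc, ← div_eq_mul_inv]
          gcongr
      _ ≤ _ := by
          rw [← Finset.sum_mul]
          have := Real.log_nonneg hx
          gcongr
  calc _ ≤ _ := step1
    _ ≤ x * (C * (1 + Real.log x)) := by gcongr
    _ = _ := by ring
end

section
/- There exists a constant B > 0 such that for every real x ≥ 1, Σ_{n > x} 2^{ω(n)}/φ(n)² ≤ B·(2 + log x)/x, the sum being over positive integers n > x. -/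
namespace TB
open Finset

noncomputable def u : ArithmeticFunction ℝ := ⟨fun n => if n = 0 then 0 else 1, by simp⟩

noncomputable def f : ArithmeticFunction ℝ := ⟨fun n => (Real.sqrt n)⁻¹, by simp⟩

lemma u_apply (n : ℕ) : u n = if n = 0 then 0 else 1 := rfl
lemma f_apply (n : ℕ) : f n = (Real.sqrt n)⁻¹ := rfl

lemma u_nonneg (n : ℕ) : 0 ≤ u n := by rw [u_apply]; split_ifs <;> norm_num
lemma f_nonneg (n : ℕ) : 0 ≤ f n := by rw [f_apply]; positivity

lemma u_mult : u.IsMultiplicative := by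
  rw [ArithmeticFunction.IsMultiplicative.iff_ne_zero]
  refine ⟨by simp [u_apply], ?_⟩
  intro m n hm hn _
  simp [u_apply, hm, hn]

lemma f_mult : f.IsMultiplicative := by
  rw [ArithmeticFunction.IsMultiplicative.iff_ne_zero]
  refine ⟨by simp [f_apply], ?_⟩
  intro m n hm hn _
  simp [f_apply, mul_comm]

noncomputable def F : ArithmeticFunction ℝ := (u * u) * f

lemma F_mult : F.IsMultiplicative := (u_mult.mul u_mult).mul f_mult

lemma uu_nonneg (n : ℕ) : 0 ≤ (u * u) n := by
  rw [ArithmeticFunction.mul_apply]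
  exact sum_nonneg fun q _ => mul_nonneg (u_nonneg _) (u_nonneg _)

lemma uu_ge_one (n : ℕ) (hn : n ≠ 0) : 1 ≤ (u * u) n := by
  rw [ArithmeticFunction.mul_apply]
  have h := single_le_sum (f := fun q : ℕ × ℕ => u q.1 * u q.2)
    (fun q _ => mul_nonneg (u_nonneg _) (u_nonneg _))
    (show (n, 1) ∈ n.divisorsAntidiagonal by simp [hn])
  simpa [u_apply, hn] using h

lemma uu_ge_two (n : ℕ) (hn : 1 < n) : 2 ≤ (u * u) n := by
  rw [ArithmeticFunction.mul_apply]
  have hn0 : n ≠ 0 := by omega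
  have h := sum_le_sum_of_subset_of_nonneg (f := fun q : ℕ × ℕ => u q.1 * u q.2)
    (s := {(n, 1), (1, n)}) (t := n.divisorsAntidiagonal)
    (by intro q hq; simp at hq; rcases hq with rfl | rfl <;> simp [hn0])
    (fun q _ _ => mul_nonneg (u_nonneg _) (u_nonneg _))
  rw [sum_pair (by simp; omega)] at h
  refine le_trans ?_ h
  simp [u_apply, hn0]
  norm_num

lemma F_pp (p k : ℕ) (hp : p.Prime) (hk : k ≠ 0) : 2 + (Real.sqrt p)⁻¹ ≤ F (p ^ k) := by
  have hp0 := hp.ne_zero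
  have h1 : 1 < p ^ k := Nat.one_lt_pow hk hp.one_lt
  unfold F
  rw [ArithmeticFunction.mul_apply]
  have h := sum_le_sum_of_subset_of_nonneg (f := fun q : ℕ × ℕ => (u * u) q.1 * f q.2)
    (s := {(p ^ k, 1), (p ^ (k-1), p)}) (t := (p ^ k).divisorsAntidiagonal)
    (by
      intro q hq; simp at hq
      rcases hq with rfl | rfl
      · simp [hp0]
      · simp [hp0, ← pow_succ, Nat.sub_add_cancel (Nat.one_le_iff_ne_zero.2 hk)])
    (fun q _ _ => mul_nonneg (uu_nonneg _) (f_nonneg _))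
  have hne := hp.ne_one
  rw [sum_pair (by simp; intro _ h; exact hne h.symm)] at h
  refine le_trans ?_ h
  have a1 := uu_ge_two _ h1
  have a2 := uu_ge_one (p ^ (k-1)) (pow_ne_zero _ hp0)
  have a3 : 0 ≤ (Real.sqrt p)⁻¹ := by positivity
  simp only [f_apply, Nat.cast_one, Real.sqrt_one, inv_one, mul_one]
  nlinarith

noncomputable def c (p : ℕ) : ℝ := if p < 100 then 4 else 1

lemma local_bd (p : ℕ) (hp : p.Prime) :
    2 / (1 - (p:ℝ)⁻¹) ^ 2 ≤ c p * (2 + (Real.sqrt p)⁻¹) := by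
  have h2 : (2:ℝ) ≤ p := by exact_mod_cast hp.two_le
  have hpos : 0 < (p:ℝ) := by linarith
  have hs : 0 < Real.sqrt p := Real.sqrt_pos.2 hpos
  have hi : (0:ℝ) ≤ (Real.sqrt p)⁻¹ := by positivity
  unfold c
  split_ifs with h
  · have : (p:ℝ)⁻¹ ≤ 2⁻¹ := inv_anti₀ (by norm_num) h2
    rw [div_le_iff₀ (by apply pow_pos; linarith)]
    nlinarith [mul_nonneg hi (sq_nonneg (1 - (p:ℝ)⁻¹))]
  · have h100 : (100:ℝ) ≤ p := by exact_mod_cast not_lt.1 h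
    have hs10 : 10 ≤ Real.sqrt p := Real.le_sqrt_of_sq_le (by linarith)
    have hsq : (p:ℝ) = Real.sqrt p ^ 2 := (Real.sq_sqrt hpos.le).symm
    set s := Real.sqrt p
    rw [hsq, one_mul]
    have e : (1 - (s^2)⁻¹) = (s^2 - 1) / s^2 := by field_simp
    have hs1 : 0 < s^2 - 1 := by nlinarith
    have e2 : 2 + s⁻¹ = (2 * s + 1) / s := by field_simp
    rw [e, e2, div_pow, div_div_eq_mul_div, div_le_div_iff₀ (by positivity) hs]
    have k1 : 10 * s^3 ≤ s^4 := by nlinarith [pow_pos hs 3]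
    have k2 : s ≤ s^3 := by nlinarith [pow_pos hs 2]
    nlinarith [k1, k2]

lemma h_eq (n : ℕ) : (2:ℝ)^(omega n) / (Nat.totient n : ℝ)^2
    = (∏ p ∈ n.primeFactors, 2 / (1 - (p:ℝ)⁻¹) ^ 2) * ((n:ℝ)^2)⁻¹ := by
  have h : (n.totient : ℝ) = n * ∏ p ∈ n.primeFactors, (1 - (p:ℝ)⁻¹) := by
    have := Nat.totient_eq_mul_prod_factors n
    have h2 := congrArg (fun q : ℚ => (q:ℝ)) this
    push_cast at h2
    exact h2
  rw [h, prod_div_distrib, prod_const, prod_pow, omega, mul_pow]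
  rw [div_mul_eq_div_div_swap]; rfl

lemma c_prod (S : Finset ℕ) : ∏ p ∈ S, c p ≤ 4 ^ 100 := by
  unfold c
  rw [prod_ite]
  simp only [prod_const, one_pow, mul_one]
  apply pow_le_pow_right₀ (by norm_num)
  calc _ ≤ (range 100).card := card_le_card (by intro a; simp)
    _ = 100 := by simp

lemma h_le (n : ℕ) (hn : n ≠ 0) : (2:ℝ)^(omega n) / (Nat.totient n : ℝ)^2
    ≤ 4 ^ 100 * (F n * ((n:ℝ)^2)⁻¹) := by
  rw [h_eq, ← mul_assoc]
  apply mul_le_mul_of_nonneg_right _ (by positivity)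
  have hF : F n = ∏ p ∈ n.primeFactors, F (p ^ n.factorization p) :=
    F_mult.multiplicative_factorization F hn
  calc _ ≤ ∏ p ∈ n.primeFactors, c p * F (p ^ n.factorization p) := by
        apply prod_le_prod
        · intros; positivity
        · intro p hp
          have hpp := Nat.prime_of_mem_primeFactors hp
          refine (local_bd p hpp).trans ?_
          apply mul_le_mul_of_nonneg_left _ (by unfold c; split_ifs <;> norm_num)
          apply F_pp p _ hpp
          exact (hpp.factorization_pos_of_dvd hn (Nat.dvd_of_mem_primeFactors hp)).ne'
    _ = (∏ p ∈ n.primeFactors, c p) * F n := by rw [prod_mul_distrib, hF]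
    _ ≤ _ := by
        apply mul_le_mul_of_nonneg_right (c_prod _)
        unfold F
        rw [ArithmeticFunction.mul_apply]
        exact sum_nonneg fun q _ => mul_nonneg (uu_nonneg _) (f_nonneg _)

/-- swapping lemma -/
lemma swap (g h : ArithmeticFunction ℝ) (hg : ∀ n, 0 ≤ g n) (hh : ∀ n, 0 ≤ h n) (y : ℝ) (N : ℕ) :
    ∑ n ∈ (Ioc 0 N).filter (fun n : ℕ => y < n), (g * h) n * ((n:ℝ)^2)⁻¹
    ≤ ∑ k ∈ Ioc 0 N, h k * ((k:ℝ)^2)⁻¹ *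
        ∑ m ∈ (Ioc 0 N).filter (fun m : ℕ => y / k < m), g m * ((m:ℝ)^2)⁻¹ := by
  have e1 : ∀ n ∈ (Ioc 0 N).filter (fun n : ℕ => y < n), (g * h) n * ((n:ℝ)^2)⁻¹ =
      ∑ k ∈ Ioc 0 N, ∑ m ∈ Ioc 0 N, if m * k = n then
        h k * ((k:ℝ)^2)⁻¹ * (g m * ((m:ℝ)^2)⁻¹) else 0 := by
    intro n hn
    simp only [mem_filter, mem_Ioc] at hn
    rw [← sum_product', ArithmeticFunction.mul_apply, sum_mul, ← sum_filter]
    refine sum_bij' (fun q _ => (q.2, q.1)) (fun q _ => (q.2, q.1)) ?_ ?_ ?_ ?_ ?_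
    · intro q hq
      rw [Nat.mem_divisorsAntidiagonal] at hq
      obtain ⟨h1, h2⟩ := hq
      have a1 : q.1 ≠ 0 := by rintro h; simp [h] at h1; omega
      have a2 : q.2 ≠ 0 := by rintro h; simp [h] at h1; omega
      have b1 : q.1 ≤ n := Nat.le_of_dvd (by omega) ⟨_, h1.symm⟩
      have b2 : q.2 ≤ n := Nat.le_of_dvd (by omega) ⟨q.1, by rw [← h1, mul_comm]⟩
      simp only [mem_filter, mem_product, mem_Ioc]
      refine ⟨⟨?_, ?_⟩, h1⟩ <;> omega
    · intro q hq
      simp only [mem_filter, mem_product, mem_Ioc] at hq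
      rw [Nat.mem_divisorsAntidiagonal]
      exact ⟨hq.2, by omega⟩
    · intros; rfl
    · intros; rfl
    · intro q hq
      rw [Nat.mem_divisorsAntidiagonal] at hq
      rw [← hq.1]
      push_cast
      rw [mul_pow, mul_inv]; ring
  rw [sum_congr rfl e1, sum_comm]
  apply sum_le_sum
  intro k hk
  rw [sum_comm, mul_sum, sum_filter]
  apply sum_le_sum
  intro m hm
  simp only [mem_Ioc] at hk hm
  have hkp : (0:ℝ) < k := by exact_mod_cast hk.1
  rw [sum_ite_eq]
  have hnn : 0 ≤ h k * ((k:ℝ)^2)⁻¹ * (g m * ((m:ℝ)^2)⁻¹) :=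
    mul_nonneg (mul_nonneg (hh _) (by positivity)) (mul_nonneg (hg _) (by positivity))
  by_cases hc : m * k ∈ (Ioc 0 N).filter (fun n : ℕ => y < n)
  · rw [if_pos hc]
    simp only [mem_filter] at hc
    have := hc.2
    push_cast at this
    rw [if_pos ((div_lt_iff₀ hkp).2 this)]
  · rw [if_neg hc]
    split_ifs
    · exact hnn
    · exact le_rfl

lemma sq_tail (y : ℝ) (hy : 0 < y) (N : ℕ) :
    ∑ m ∈ (Ioc 0 N).filter (fun m : ℕ => y < m), ((m:ℝ)^2)⁻¹ ≤ 2 / (⌊y⌋₊ + 1) := by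
  refine le_trans ?_ (sum_Ioo_inv_sq_le (α := ℝ) ⌊y⌋₊ (N+1))
  apply sum_le_sum_of_subset_of_nonneg
  · intro m hm
    simp only [mem_filter, mem_Ioc, mem_Ioo] at *
    exact ⟨(Nat.floor_lt hy.le).2 hm.2, by omega⟩
  · intros; positivity

lemma sq_tail1 (y : ℝ) (hy : 0 < y) (N : ℕ) :
    ∑ m ∈ (Ioc 0 N).filter (fun m : ℕ => y < m), ((m:ℝ)^2)⁻¹ ≤ 2 / y :=
  (sq_tail y hy N).trans (div_le_div_of_nonneg_left (by norm_num) hy (Nat.lt_floor_add_one y).le)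

lemma sq_tail2 (y : ℝ) (hy : 0 < y) (N : ℕ) :
    ∑ m ∈ (Ioc 0 N).filter (fun m : ℕ => y < m), ((m:ℝ)^2)⁻¹ ≤ 2 := by
  refine (sq_tail y hy N).trans ?_
  rw [div_le_iff₀ (by positivity)]
  have : (0:ℝ) ≤ ⌊y⌋₊ := by positivity
  linarith

lemma tau_tail (x y : ℝ) (hx : 1 ≤ x) (hy : 0 < y) (hyx : y ≤ x) (N : ℕ) :
    ∑ m ∈ (Ioc 0 N).filter (fun m : ℕ => y < m), (u * u) m * ((m:ℝ)^2)⁻¹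
      ≤ 6 * (2 + Real.log x) / y := by
  have hlx : 0 ≤ Real.log x := Real.log_nonneg hx
  refine (swap u u u_nonneg u_nonneg y N).trans ?_
  have hin : ∀ z : ℝ, ∑ m ∈ (Ioc 0 N).filter (fun m : ℕ => z < m), u m * ((m:ℝ)^2)⁻¹
      = ∑ m ∈ (Ioc 0 N).filter (fun m : ℕ => z < m), ((m:ℝ)^2)⁻¹ := by
    intro z
    apply sum_congr rfl
    intro m hm
    simp only [mem_filter, mem_Ioc] at hm
    rw [u_apply, if_neg (by omega), one_mul]
  simp only [hin]
  rw [← sum_filter_add_sum_filter_not _ (fun k : ℕ => y < k)]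
  have p1 : ∑ k ∈ (Ioc 0 N).filter (fun k : ℕ => y < k), u k * ((k:ℝ)^2)⁻¹ *
      ∑ m ∈ (Ioc 0 N).filter (fun m : ℕ => y / k < m), ((m:ℝ)^2)⁻¹ ≤ 4 / y := by
    calc _ ≤ ∑ k ∈ (Ioc 0 N).filter (fun k : ℕ => y < k), ((k:ℝ)^2)⁻¹ * 2 := by
          apply sum_le_sum
          intro k hk
          simp only [mem_filter, mem_Ioc] at hk
          have hkp : (0:ℝ) < k := by exact_mod_cast hk.1.1
          rw [u_apply, if_neg (by omega), one_mul]
          exact mul_le_mul_of_nonneg_left (sq_tail2 _ (by positivity) N) (by positivity)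
      _ ≤ 4 / y := by
          rw [← sum_mul]
          have := sq_tail1 y hy N
          calc _ ≤ 2 / y * 2 := by linarith
            _ = _ := by ring
  have p2 : ∑ k ∈ (Ioc 0 N).filter (fun k : ℕ => ¬ y < k), u k * ((k:ℝ)^2)⁻¹ *
      ∑ m ∈ (Ioc 0 N).filter (fun m : ℕ => y / k < m), ((m:ℝ)^2)⁻¹
      ≤ 2 * (1 + Real.log x) / y := by
    calc _ ≤ ∑ k ∈ (Ioc 0 N).filter (fun k : ℕ => ¬ y < k), (k:ℝ)⁻¹ * (2 / y) := by
          apply sum_le_sum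
          intro k hk
          simp only [mem_filter, mem_Ioc] at hk
          have hkp : (0:ℝ) < k := by exact_mod_cast hk.1.1
          rw [u_apply, if_neg (by omega), one_mul]
          calc _ ≤ ((k:ℝ)^2)⁻¹ * (2 / (y / k)) :=
                mul_le_mul_of_nonneg_left (sq_tail1 _ (by positivity) N) (by positivity)
            _ = _ := by field_simp
      _ ≤ ∑ k ∈ Icc 1 ⌊x⌋₊, (k:ℝ)⁻¹ * (2 / y) := by
          apply sum_le_sum_of_subset_of_nonneg
          · intro k hk
            simp only [mem_filter, mem_Ioc, mem_Icc, not_lt] at *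
            exact ⟨hk.1.1, Nat.le_floor (hk.2.trans hyx)⟩
          · intros; positivity
      _ ≤ _ := by
          have := harmonic_floor_le_one_add_log x hx
          rw [harmonic_eq_sum_Icc] at this
          push_cast at this
          rw [← sum_mul]
          calc _ ≤ (1 + Real.log x) * (2 / y) :=
                mul_le_mul_of_nonneg_right this (by positivity)
            _ = _ := by ring
  calc _ ≤ 4 / y + 2 * (1 + Real.log x) / y := add_le_add p1 p2
    _ = (6 + 2 * Real.log x) / y := by ring
    _ ≤ _ := div_le_div_of_nonneg_right (by linarith) hy.le

lemma summ : Summable (fun k : ℕ => f k * (k:ℝ)⁻¹) := by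
  have := (Real.summable_nat_rpow_inv (p := 3/2)).2 (by norm_num)
  refine this.congr ?_
  intro k
  rcases Nat.eq_zero_or_pos k with rfl | hk
  · simp
  · have hkp : (0:ℝ) < k := by exact_mod_cast hk
    rw [f_apply, Real.sqrt_eq_rpow, ← mul_inv, ← Real.rpow_add_one hkp.ne']
    norm_num

lemma F_tail (x : ℝ) (hx : 1 ≤ x) (N : ℕ) :
    ∑ n ∈ (Ioc 0 N).filter (fun n : ℕ => x < n), F n * ((n:ℝ)^2)⁻¹
      ≤ (∑' k : ℕ, f k * (k:ℝ)⁻¹) * (6 * (2 + Real.log x) / x) := by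
  have hlx : 0 ≤ Real.log x := Real.log_nonneg hx
  have hx0 : 0 < x := by linarith
  refine (swap (u * u) f uu_nonneg f_nonneg x N).trans ?_
  calc _ ≤ ∑ k ∈ Ioc 0 N, f k * (k:ℝ)⁻¹ * (6 * (2 + Real.log x) / x) := by
        apply sum_le_sum
        intro k hk
        simp only [mem_Ioc] at hk
        have hkp : (0:ℝ) < k := by exact_mod_cast hk.1
        have hk1 : (1:ℝ) ≤ k := by exact_mod_cast hk.1
        calc _ ≤ f k * ((k:ℝ)^2)⁻¹ * (6 * (2 + Real.log x) / (x / k)) :=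
              mul_le_mul_of_nonneg_left
                (tau_tail x (x / k) hx (by positivity) (div_le_self hx0.le hk1) N)
                (mul_nonneg (f_nonneg _) (by positivity))
          _ = _ := by field_simp
    _ ≤ _ := by
        rw [← sum_mul]
        apply mul_le_mul_of_nonneg_right _ (by positivity)
        exact summ.sum_le_tsum _ (fun k _ => mul_nonneg (f_nonneg _) (by positivity))

end TB

theorem tail_sum_bound :
    ∃ B : ℝ, 0 < B ∧ ∀ x : ℝ, 1 ≤ x →
      (∑' n : {n : ℕ // x < (n:ℝ)}, (2:ℝ)^(omega n.1) / (Nat.totient n.1 : ℝ)^2)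
        ≤ B * (2 + Real.log x) / x := by
  have hZ : 0 ≤ ∑' k : ℕ, TB.f k * (k:ℝ)⁻¹ :=
    tsum_nonneg fun k => mul_nonneg (TB.f_nonneg _) (by positivity)
  set Z := ∑' k : ℕ, TB.f k * (k:ℝ)⁻¹ with hZd
  refine ⟨4 ^ 100 * (Z * 6) + 1, by positivity, ?_⟩
  intro x hx
  have hlx : 0 ≤ Real.log x := Real.log_nonneg hx
  have hx0 : 0 < x := by linarith
  apply Real.tsum_le_of_sum_le
  · intro n; positivity
  intro S
  have hmap : ∑ n ∈ S, (2:ℝ)^(omega n.1) / (Nat.totient n.1 : ℝ)^2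
      = ∑ n ∈ S.map (Function.Embedding.subtype _),
        (2:ℝ)^(omega n) / (Nat.totient n : ℝ)^2 := by
    rw [Finset.sum_map]; rfl
  rw [hmap]
  set T := S.map (Function.Embedding.subtype _) with hT
  have hTx : ∀ n ∈ T, x < (n:ℝ) := by
    intro n hn
    rw [hT, Finset.mem_map] at hn
    obtain ⟨a, _, rfl⟩ := hn
    exact a.2
  have hT0 : ∀ n ∈ T, n ≠ 0 := by
    rintro n hn rfl
    have := hTx _ hn
    simp at this
    linarith
  calc _ ≤ ∑ n ∈ T, 4 ^ 100 * (TB.F n * ((n:ℝ)^2)⁻¹) :=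
        Finset.sum_le_sum fun n hn => TB.h_le n (hT0 n hn)
    _ ≤ ∑ n ∈ (Finset.Ioc 0 (T.sup id)).filter (fun n : ℕ => x < n),
          4 ^ 100 * (TB.F n * ((n:ℝ)^2)⁻¹) := by
        apply Finset.sum_le_sum_of_subset_of_nonneg
        · intro n hn
          simp only [Finset.mem_filter, Finset.mem_Ioc]
          exact ⟨⟨Nat.pos_of_ne_zero (hT0 n hn), Finset.le_sup (f := id) hn⟩, hTx n hn⟩
        · intro n hn _
          simp only [Finset.mem_filter, Finset.mem_Ioc] at hn
          refine le_trans ?_ (TB.h_le n (by omega))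
          positivity
    _ = 4 ^ 100 * ∑ n ∈ (Finset.Ioc 0 (T.sup id)).filter (fun n : ℕ => x < n),
          (TB.F n * ((n:ℝ)^2)⁻¹) := by rw [Finset.mul_sum]
    _ ≤ 4 ^ 100 * (Z * (6 * (2 + Real.log x) / x)) :=
        mul_le_mul_of_nonneg_left (TB.F_tail x hx _) (by positivity)
    _ = (4 ^ 100 * (Z * 6)) * (2 + Real.log x) / x := by ring
    _ ≤ _ := by
        apply div_le_div_of_nonneg_right _ hx0.le
        apply mul_le_mul_of_nonneg_right _ (by positivity)
        linarith
end

section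
/- For every real x ≥ 1, the number of squarefull integers N with 1 ≤ N ≤ x is at most η·√x, where η = ζ(3/2)/ζ(3) = 2.17325… and ζ is the Riemann zeta function. -/
theorem aux_zeta1 : riemannZeta (3/2) = ((∑' n : ℕ, 1 / (n:ℝ)^(3/2:ℝ) : ℝ) : ℂ) := by
  rw [zeta_eq_tsum_one_div_nat_cpow (by norm_num), Complex.ofReal_tsum]
  refine tsum_congr fun n => ?_
  rw [Complex.ofReal_div, Complex.ofReal_cpow (by positivity)]
  norm_num

theorem aux_zeta2 : riemannZeta 3 = ((∑' n : ℕ, 1 / ((n:ℝ)+1)^3 : ℝ) : ℂ) := by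
  rw [zeta_eq_tsum_one_div_nat_add_one_cpow (by norm_num), Complex.ofReal_tsum]
  refine tsum_congr fun n => ?_
  have : (3:ℂ) = ((3:ℕ):ℂ) := by norm_num
  rw [this, Complex.cpow_natCast]
  push_cast
  rfl

theorem aux_inj {a b c d : ℕ} (ha : a ≠ 0) (hc : c ≠ 0) (hb : Squarefree b) (hd : Squarefree d)
    (h : b * a^2 = d * c^2) : b = d ∧ a = c := by
  have hbd : b = d := by
    refine Nat.eq_of_factorization_eq hb.ne_zero hd.ne_zero fun p => ?_
    have h1 := hb.natFactorization_le_one p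
    have h2 := hd.natFactorization_le_one p
    have h3 := congrArg (fun n => n.factorization p) h
    simp only [Nat.factorization_mul hb.ne_zero (pow_ne_zero 2 ha),
      Nat.factorization_mul hd.ne_zero (pow_ne_zero 2 hc), Nat.factorization_pow,
      Finsupp.add_apply, Finsupp.smul_apply, smul_eq_mul] at h3
    omega
  refine ⟨hbd, ?_⟩
  subst hbd
  have := Nat.eq_of_mul_eq_mul_left (Nat.pos_of_ne_zero hb.ne_zero) h
  exact Nat.pow_left_injective (n := 2) (by norm_num) this

theorem aux_decomp {N : ℕ} (h : Squarefull N) (hN : 1 ≤ N) :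
    ∃ a b : ℕ, Squarefree b ∧ 1 ≤ a ∧ N = a^2 * b^3 := by
  obtain ⟨b, s, hbs, hb⟩ := Nat.sq_mul_squarefree N
  have hdvd : b ∣ s := by
    rw [← Nat.prod_primeFactors_of_squarefree hb]
    refine Finset.prod_primes_dvd _ (fun p hp => (Nat.prime_of_mem_primeFactors hp).prime) ?_
    intro p hp
    have pp := Nat.prime_of_mem_primeFactors hp
    have hpb := Nat.dvd_of_mem_primeFactors hp
    by_contra hps
    have h2 := h p pp (hbs ▸ Dvd.dvd.mul_left hpb _)
    rw [← hbs] at h2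
    have hco : Nat.Coprime (p^2) (s^2) := Nat.Coprime.pow 2 2 ((Nat.Prime.coprime_iff_not_dvd pp).2 hps)
    have h3 := hco.dvd_of_dvd_mul_left h2
    rw [pow_two] at h3
    exact pp.one_lt.ne' (Nat.isUnit_iff.1 (hb p h3))
  obtain ⟨a, rfl⟩ := hdvd
  refine ⟨a, b, hb, ?_, ?_⟩
  · rcases Nat.eq_zero_or_pos a with rfl | h0
    · simp at hbs; omega
    · exact h0
  · rw [← hbs]; ring

theorem aux_sum (B : Finset ℕ) (hB : ∀ b ∈ B, Squarefree b) :
    ∑ b ∈ B, 1 / (b:ℝ)^(3/2:ℝ) ≤ eta := by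
  have hs1 : Summable (fun n : ℕ => 1 / (n:ℝ)^(3/2:ℝ)) :=
    Real.summable_one_div_nat_rpow.2 (by norm_num)
  have hs2 : Summable (fun n : ℕ => 1 / ((n:ℝ)+1)^3) := by
    have := (summable_nat_add_iff 1).2 (Real.summable_one_div_nat_pow.2 (by norm_num : 1 < 3))
    simpa using this
  have hpos : 0 < ∑' n : ℕ, 1 / ((n:ℝ)+1)^3 :=
    hs2.tsum_pos (fun n => by positivity) 0 (by norm_num)
  unfold eta
  rw [aux_zeta1, aux_zeta2, ← Complex.ofReal_div, Complex.ofReal_re, le_div_iff₀ hpos]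
  rw [← tsum_mul_left]
  refine (hs2.mul_left _).tsum_le_of_sum_le fun A => ?_
  rw [← Finset.mul_sum, Finset.sum_mul_sum, ← Finset.sum_product']
  calc ∑ x ∈ B ×ˢ A, 1 / (x.1:ℝ)^(3/2:ℝ) * (1 / ((x.2:ℝ)+1)^3)
      = ∑ n ∈ (B ×ˢ A : Finset (ℕ × ℕ)).image (fun x : ℕ × ℕ => (x.1 * (x.2+1)^2 : ℕ)), 1 / ((n:ℕ):ℝ)^(3/2:ℝ) := by
        rw [Finset.sum_image]
        · refine Finset.sum_congr rfl fun x _ => ?_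
          push_cast
          rw [Real.mul_rpow (by positivity) (by positivity), ← Real.rpow_natCast_mul (by positivity)]
          rw [show ((2:ℕ):ℝ) * (3/2) = ((3:ℕ):ℝ) by norm_num, Real.rpow_natCast]
          rw [one_div_mul_one_div]
        · intro x hx y hy h
          simp only [Finset.coe_product, Set.mem_prod, Finset.mem_coe] at hx hy
          obtain ⟨h1, h2⟩ := aux_inj (Nat.succ_ne_zero _) (Nat.succ_ne_zero _) (hB _ hx.1) (hB _ hy.1) h
          exact Prod.ext h1 (by omega)
    _ ≤ _ := hs1.sum_le_tsum _ (fun n _ => by positivity)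

theorem squarefull_count (x : ℝ) (hx : 1 ≤ x) :
    (Set.ncard {N : ℕ | Squarefull N ∧ 1 ≤ N ∧ (N:ℝ) ≤ x} : ℝ) ≤ eta * Real.sqrt x := by
  classical
  set B := (Finset.range (⌊x⌋₊ + 1)).filter Squarefree with hBdef
  set T := B.biUnion fun b => (Finset.Icc 1 ⌊Real.sqrt x * (1 / (b:ℝ)^(3/2:ℝ))⌋₊).image
    fun a => a^2 * b^3 with hT
  have hsub : {N : ℕ | Squarefull N ∧ 1 ≤ N ∧ (N:ℝ) ≤ x} ⊆ (T : Set ℕ) := by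
    rintro N ⟨hN, h1, hNx⟩
    obtain ⟨a, b, hb, ha, rfl⟩ := aux_decomp hN h1
    have hb1 : 1 ≤ b := Nat.pos_of_ne_zero hb.ne_zero
    have hle : b ≤ a^2 * b^3 := by
      calc b = 1 * b^1 := by ring
        _ ≤ a^2 * b^3 := Nat.mul_le_mul (Nat.one_le_pow _ _ ha) (Nat.pow_le_pow_right hb1 (by norm_num))
    have hbpos : (0:ℝ) < (b:ℝ)^(3/2:ℝ) := Real.rpow_pos_of_pos (by exact_mod_cast hb1) _
    simp only [hT, hBdef, Finset.coe_biUnion, Set.mem_iUnion, Finset.mem_coe, Finset.mem_image,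
      Finset.mem_filter, Finset.mem_range, Finset.mem_Icc, exists_prop]
    refine ⟨b, ⟨Nat.lt_succ_of_le (Nat.le_floor ((Nat.cast_le.2 hle).trans hNx)), hb⟩, a,
      ⟨ha, Nat.le_floor ?_⟩, rfl⟩
    rw [mul_one_div, le_div_iff₀ hbpos]
    refine Real.le_sqrt_of_sq_le ?_
    rw [mul_pow, ← Real.rpow_mul_natCast (by positivity),
      show (3/2:ℝ) * ((2:ℕ):ℝ) = ((3:ℕ):ℝ) by norm_num, Real.rpow_natCast]
    exact_mod_cast hNx
  calc (Set.ncard {N : ℕ | Squarefull N ∧ 1 ≤ N ∧ (N:ℝ) ≤ x} : ℝ)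
      ≤ (T.card : ℝ) := by
        rw [← Set.ncard_coe_finset]
        exact_mod_cast Set.ncard_le_ncard hsub T.finite_toSet
    _ ≤ ((∑ b ∈ B, ⌊Real.sqrt x * (1 / (b:ℝ)^(3/2:ℝ))⌋₊ : ℕ) : ℝ) := by
        refine Nat.cast_le.2 (Finset.card_biUnion_le.trans (Finset.sum_le_sum fun b _ => ?_))
        exact Finset.card_image_le.trans (by simp)
    _ ≤ ∑ b ∈ B, Real.sqrt x * (1 / (b:ℝ)^(3/2:ℝ)) := by
        push_cast
        exact Finset.sum_le_sum fun b _ => Nat.floor_le (by positivity)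
    _ = (∑ b ∈ B, 1 / (b:ℝ)^(3/2:ℝ)) * Real.sqrt x := by rw [← Finset.mul_sum, mul_comm]
    _ ≤ eta * Real.sqrt x :=
        mul_le_mul_of_nonneg_right (aux_sum B fun b hb => (Finset.mem_filter.1 hb).2)
          (Real.sqrt_nonneg x)
end

section
/- For every even integer k ≥ 2, every r ∈ ℕ, and every ⋆ ∈ {new, min}, the set { d_k^⋆(N) − ((k−1)/12)·ψ^⋆(N) : N ∈ ℕ, ω(N) < r, N is not a perfect square } has cardinality at most 3·(2r+1)², where ω(N) is the number of distinct prime divisors of N. -/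
def LocVal (x : ℝ) : Prop := x = 0 ∨ x = 1 ∨ x = -1 ∨ x = 2 ∨ x = -2

open Classical in
noncomputable def valS (r : ℕ) : Finset ℝ :=
  insert 0 ((Finset.range r).image (fun j => (2:ℝ)^j) ∪ (Finset.range r).image (fun j => -(2:ℝ)^j))

lemma valS_card (r : ℕ) : (valS r).card ≤ 2*r+1 := by
  classical
  unfold valS
  refine (Finset.card_insert_le _ _).trans ?_
  have h := Finset.card_union_le ((Finset.range r).image (fun j => (2:ℝ)^j))
    ((Finset.range r).image (fun j => -(2:ℝ)^j))
  have h1 := Finset.card_image_le (s := Finset.range r) (f := fun j => (2:ℝ)^j)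
  have h2 := Finset.card_image_le (s := Finset.range r) (f := fun j => -(2:ℝ)^j)
  rw [Finset.card_range] at h1 h2
  omega

lemma mem_valS (r : ℕ) (x : ℝ) :
    x ∈ valS r ↔ x = 0 ∨ ∃ j < r, x = 2^j ∨ x = -2^j := by
  classical
  simp only [valS, Finset.mem_insert, Finset.mem_union, Finset.mem_image, Finset.mem_range]
  constructor
  · rintro (h | ⟨j, hj, rfl⟩ | ⟨j, hj, rfl⟩)
    · exact Or.inl h
    · exact Or.inr ⟨j, hj, Or.inl rfl⟩
    · exact Or.inr ⟨j, hj, Or.inr rfl⟩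
  · rintro (h | ⟨j, hj, rfl | rfl⟩)
    · exact Or.inl h
    · exact Or.inr (Or.inl ⟨j, hj, rfl⟩)
    · exact Or.inr (Or.inr ⟨j, hj, rfl⟩)

lemma prod_mem_valS (s : Finset ℕ) (f : ℕ → ℝ) (hf : ∀ p ∈ s, LocVal (f p)) :
    ∏ p ∈ s, f p ∈ valS (s.card + 1) := by
  classical
  induction s using Finset.induction_on with
  | empty => rw [mem_valS]; right; exact ⟨0, by simp, by simp⟩
  | insert a s ha ih =>
    have h1 := ih fun p hp => hf p (Finset.mem_insert_of_mem hp)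
    have h2 := hf a (Finset.mem_insert_self _ _)
    rw [Finset.prod_insert ha, Finset.card_insert_of_notMem ha]
    rw [mem_valS] at h1 ⊢
    rcases h1 with h1 | ⟨j, hj, h1⟩
    · left; rw [h1, mul_zero]
    · rcases h2 with h2 | h2 | h2 | h2 | h2
      · left; rw [h2, zero_mul]
      · right; refine ⟨j, by omega, ?_⟩
        rw [h2]; simpa using h1
      · right; refine ⟨j, by omega, ?_⟩
        rcases h1 with h1 | h1 <;> rw [h1, h2] <;> simp
      · right; refine ⟨j+1, by omega, ?_⟩
        rcases h1 with h1 | h1 <;> rw [h1, h2]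
        · left; ring
        · right; ring
      · right; refine ⟨j+1, by omega, ?_⟩
        rcases h1 with h1 | h1 <;> rw [h1, h2]
        · right; ring
        · left; ring

lemma mval_mem (f : ℕ → ℕ → ℝ) (hf : ∀ p e, LocVal (f p e)) (N r : ℕ) (h : omega N < r) :
    mval f N ∈ valS r := by
  have h1 := prod_mem_valS N.primeFactors (fun p => f p (N.factorization p)) fun p _ => hf _ _
  rw [mem_valS] at h1 ⊢
  rcases h1 with h1 | ⟨j, hj, h1⟩
  · exact Or.inl h1
  · exact Or.inr ⟨j, by unfold omega at h; omega, h1⟩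

lemma exists_odd (N : ℕ) (h1 : 1 ≤ N) (h : ¬ IsSquare N) :
    ∃ p ∈ N.primeFactors, ¬ Even (N.factorization p) := by
  by_contra! hc
  apply h
  rw [← Nat.prod_factorization_pow_eq_self (n := N) (by omega)]
  refine ⟨∏ p ∈ N.primeFactors, p ^ (N.factorization p / 2), ?_⟩
  rw [← Finset.prod_mul_distrib]
  refine Finset.prod_congr (by simp) fun p hp => ?_
  have := Nat.div_two_mul_two_of_even (hc p (by simpa using hp))
  rw [← pow_add]; congr 1; omega

lemma mval_zero (f : ℕ → ℕ → ℝ) (hf : ∀ p e, ¬ Even e → f p e = 0) (N : ℕ)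
    (h1 : 1 ≤ N) (h : ¬ IsSquare N) : mval f N = 0 := by
  obtain ⟨p, hp, ho⟩ := exists_odd N h1 h
  exact Finset.prod_eq_zero hp (hf _ _ ho)

lemma nuInfNew_zero (N : ℕ) (h1 : 1 ≤ N) (h : ¬ IsSquare N) : nuInfNew N = 0 := by
  refine mval_zero _ (fun p e he => ?_) N h1 h
  have h2 : e ≠ 2 := by rintro rfl; exact he (by decide)
  simp [he, h2]

lemma nuInfMin_zero (N : ℕ) (h1 : 1 ≤ N) (h : ¬ IsSquare N) : nuInfMin N = 0 := by
  refine mval_zero _ (fun p e he => ?_) N h1 h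
  simp [he]

lemma moebius_three (N : ℕ) :
    ((ArithmeticFunction.moebius N : ℤ) : ℝ) ∈ ({0, 1, -1} : Finset ℝ) := by
  rcases ArithmeticFunction.moebius_eq_or N with h | h | h <;> simp [h]

lemma locVal_moebius (n : ℕ) : LocVal (-2*((ArithmeticFunction.moebius n : ℤ) : ℝ)) := by
  unfold LocVal
  rcases ArithmeticFunction.moebius_eq_or n with h | h | h <;> simp [h]

lemma nu2New_mem (N r : ℕ) (h : omega N < r) : nu2New N ∈ valS r := by
  refine mval_mem _ (fun p e => ?_) N r h
  split_ifs <;> simp [LocVal]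

lemma nu3New_mem (N r : ℕ) (h : omega N < r) : nu3New N ∈ valS r := by
  refine mval_mem _ (fun p e => ?_) N r h
  split_ifs <;> simp [LocVal]

lemma nu2Min_mem (N r : ℕ) (h : omega N < r) : nu2Min N ∈ valS r := by
  refine mval_mem _ (fun p e => ?_) N r h
  split_ifs
  · exact locVal_moebius _
  all_goals simp [LocVal]

lemma nu3Min_mem (N r : ℕ) (h : omega N < r) : nu3Min N ∈ valS r := by
  refine mval_mem _ (fun p e => ?_) N r h
  split_ifs
  · exact locVal_moebius _
  all_goals simp [LocVal]

lemma ncard_bound (a b c : ℝ) (r : ℕ) (S : Set ℝ)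
    (hS : ∀ y ∈ S, ∃ u ∈ valS r, ∃ v ∈ valS r, ∃ w ∈ ({0, 1, -1} : Finset ℝ),
      y = a * u + b * v + c * w) : S.ncard ≤ 3*(2*r+1)^2 := by
  classical
  let T : Finset ℝ := ((valS r ×ˢ valS r) ×ˢ ({0, 1, -1} : Finset ℝ)).image
    (fun q => a * q.1.1 + b * q.1.2 + c * q.2)
  have hsub : S ⊆ (T : Set ℝ) := by
    intro y hy
    obtain ⟨u, hu, v, hv, w, hw, rfl⟩ := hS y hy
    exact Finset.mem_coe.2 (Finset.mem_image.2
      ⟨((u, v), w), Finset.mem_product.2 ⟨Finset.mem_product.2 ⟨hu, hv⟩, hw⟩, rfl⟩)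
  have h1 := Set.ncard_le_ncard hsub T.finite_toSet
  rw [Set.ncard_coe_finset] at h1
  have h2 : T.card ≤ ((valS r).card * (valS r).card) * ({0, 1, -1} : Finset ℝ).card := by
    rw [← Finset.card_product, ← Finset.card_product]; exact Finset.card_image_le
  have h3 : ({0, 1, -1} : Finset ℝ).card ≤ 3 := Finset.card_le_three
  have h4 := valS_card r
  calc S.ncard ≤ _ := h1.trans h2
    _ ≤ ((2*r+1) * (2*r+1)) * 3 := by gcongr
    _ = _ := by ring

theorem values_newmin (k : ℕ) (hk2 : 2 ≤ k) (hk : Even k) (r : ℕ) :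
    Set.ncard {y : ℝ | ∃ N : ℕ, 1 ≤ N ∧ omega N < r ∧ ¬ IsSquare N ∧
        y = dNew k N - ((k:ℝ)-1)/12 * psiNew N} ≤ 3*(2*r+1)^2 ∧
    Set.ncard {y : ℝ | ∃ N : ℕ, 1 ≤ N ∧ omega N < r ∧ ¬ IsSquare N ∧
        y = dMin k N - ((k:ℝ)-1)/12 * psiMin N} ≤ 3*(2*r+1)^2 := by
  constructor
  · refine ncard_bound (c2 k) (c3 k) (delta2 k) r _ ?_
    rintro y ⟨N, h1, h2, h3, rfl⟩
    refine ⟨_, nu2New_mem N r h2, _, nu3New_mem N r h2, _, moebius_three N, ?_⟩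
    unfold dNew
    rw [nuInfNew_zero N h1 h3]
    ring
  · refine ncard_bound (c2 k) (c3 k) (delta2 k) r _ ?_
    rintro y ⟨N, h1, h2, h3, rfl⟩
    refine ⟨_, nu2Min_mem N r h2, _, nu3Min_mem N r h2, _, moebius_three N, ?_⟩
    unfold dMin
    rw [nuInfMin_zero N h1 h3]
    ring
end
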